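/- arXiv:1508.02471 — 9 statements merged into one kernel-verified Lean document; each statement's English description precedes it below -/
import Mathlib

section
/- (Proposition 1, Algorithm Cheap.) In the exploration model, suppose each agent with label ℓ executes the schedule: one exploration phase, then 2ℓ waiting phases (a wait of 2ℓ·E rounds), then one exploration phase. Then for any distinct labels ℓ_A, ℓ_B ∈ {1,…,L}, any distinct starting nodes, and any delay τ ≥ 1, the agents meet no later than round (2·min(ℓ_A,ℓ_B)+3)·E; in particular rendezvous is completed in time at most (2L+1)·E, and the total cost is at most 3E. -/
/-- Node reached at the start of phase `k` (phases numbered from 0, each lasting `E` rounds):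
in an exploration phase (schedule value `true`) the agent follows `expl` for `E` steps;
in a waiting phase it stays put. -/
def startOfPhase {V : Type*} (expl : V → ℕ → V) (E : ℕ) (T : ℕ → Bool) (p : V) : ℕ → V
  | 0 => p
  | k + 1 => if T k then expl (startOfPhase expl E T p k) E else startOfPhase expl E T p k

/-- Position at round `t` of an agent with schedule `T`, starting node `p` and wake-up round `τ`:
before waking it sits at `p`; after waking it executes its phases, each lasting `E` rounds. -/
def agentPos {V : Type*} (expl : V → ℕ → V) (E : ℕ) (T : ℕ → Bool) (p : V) (τ t : ℕ) : V :=
  if t < τ then p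
  else if T ((t - τ) / E) then expl (startOfPhase expl E T p ((t - τ) / E)) ((t - τ) % E)
  else startOfPhase expl E T p ((t - τ) / E)

/-- The first round at which the two agents occupy the same node. -/
noncomputable def meetRound {V : Type*} (expl : V → ℕ → V) (E : ℕ) (TA TB : ℕ → Bool) (pA pB : V)
    (τA τB : ℕ) : ℕ :=
  sInf {t | agentPos expl E TA pA τA t = agentPos expl E TB pB τB t}

/-- Cost incurred by an agent by round `t`: the number of rounds up to round `t` that belong to
its exploration phases. -/
def agentCost (E : ℕ) (T : ℕ → Bool) (τ t : ℕ) : ℕ :=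
  ((Finset.range (t - τ)).filter fun s => T (s / E) = true).card

/-- Algorithm `Cheap` for label `ℓ`: one exploration phase, then `2ℓ` waiting phases,
then one exploration phase (then wait forever). -/
def cheapSched (ℓ : ℕ) : ℕ → Bool := fun k => decide (k = 0 ∨ k = 2 * ℓ + 1)

theorem startOfPhase_cheapSched {V : Type*} (expl : V → ℕ → V) (E ℓ : ℕ) (p : V) {k : ℕ}
    (hk : k ≤ 2 * ℓ) : startOfPhase expl E (cheapSched ℓ) p (k + 1) = expl p E := by
  induction k with
  | zero => simp [startOfPhase, cheapSched]
  | succ k ih =>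
    have hT : cheapSched ℓ (k + 1) = false := by
      simp only [cheapSched, decide_eq_false_iff_not]; omega
    rw [startOfPhase, hT]
    simpa using ih (by omega)

/-- In an exploration phase `k`, the agent's position follows `expl`, endpoint included. -/
theorem agentPos_of_exploring {V : Type*} {expl : V → ℕ → V} (hexpl0 : ∀ v, expl v 0 = v)
    {E : ℕ} (hE : 1 ≤ E) {T : ℕ → Bool} (p : V) (τ : ℕ) {k i : ℕ} (hT : T k = true) (hi : i ≤ E) :
    agentPos expl E T p τ (τ + (k * E + i)) = expl (startOfPhase expl E T p k) i := by
  rw [agentPos, if_neg (by omega), Nat.add_sub_cancel_left]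
  rcases hi.lt_or_eq with hi | rfl
  · have hdiv : (k * E + i) / E = k := by
      rw [Nat.div_eq_iff (by omega)]; constructor <;> grind
    have hmod : (k * E + i) % E = i := by
      rw [Nat.mul_add_mod_self_right, Nat.mod_eq_of_lt hi]
    rw [hdiv, hmod, if_pos hT]
  · have hdiv : (k * i + i) / i = k + 1 := by
      rw [← Nat.succ_mul, Nat.mul_div_cancel _ hE]
    have hmod : (k * i + i) % i = 0 := by
      rw [← Nat.succ_mul, Nat.mul_mod_left]
    rw [hdiv, hmod, hexpl0, ite_self, startOfPhase, if_pos hT]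

/-- Between its two explorations, an agent running `Cheap` sits where the first one ended. -/
theorem agentPos_cheapSched_of_waiting {V : Type*} {expl : V → ℕ → V}
    (hexpl0 : ∀ v, expl v 0 = v) {E : ℕ} (hE : 1 ≤ E) {ℓ τ t : ℕ} (p : V)
    (h₁ : τ + E ≤ t) (h₂ : t ≤ τ + (2 * ℓ + 1) * E) :
    agentPos expl E (cheapSched ℓ) p τ t = expl p E := by
  rcases h₂.lt_or_eq with h₂ | rfl
  · have hlo : 1 ≤ (t - τ) / E := (Nat.le_div_iff_mul_le hE).2 (by omega)
    have hhi : (t - τ) / E < 2 * ℓ + 1 := (Nat.div_lt_iff_lt_mul hE).2 (by omega)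
    obtain ⟨k, hk⟩ := Nat.exists_eq_add_of_le' hlo
    have hT : cheapSched ℓ (k + 1) = false := by
      simp only [cheapSched, decide_eq_false_iff_not]; omega
    rw [agentPos, if_neg (by omega), hk, hT, startOfPhase_cheapSched _ _ _ _ (by omega)]
    simp
  · have h := agentPos_of_exploring hexpl0 hE (T := cheapSched ℓ) (k := 2 * ℓ + 1) (i := 0) p τ
      (by simp [cheapSched]) (Nat.zero_le _)
    rwa [hexpl0, startOfPhase_cheapSched _ _ _ _ le_rfl] at h

theorem agentPos_of_le {V : Type*} {expl : V → ℕ → V} (hexpl0 : ∀ v, expl v 0 = v)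
    (E : ℕ) (T : ℕ → Bool) (p : V) {τ t : ℕ} (h : t ≤ τ) : agentPos expl E T p τ t = p := by
  rcases h.lt_or_eq with h | rfl
  · rw [agentPos, if_pos h]
  · simp [agentPos, startOfPhase, hexpl0]

theorem agentCost_le_sub (E : ℕ) (T : ℕ → Bool) (τ t : ℕ) : agentCost E T τ t ≤ t - τ :=
  (Finset.card_filter_le _ _).trans (Finset.card_range _).le

theorem agentCost_cheapSched_le_two_mul {E : ℕ} (hE : 1 ≤ E) (ℓ τ t : ℕ) :
    agentCost E (cheapSched ℓ) τ t ≤ 2 * E := by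
  have hsub : ((Finset.range (t - τ)).filter fun s => cheapSched ℓ (s / E) = true) ⊆
      Finset.range E ∪ Finset.Ico ((2 * ℓ + 1) * E) ((2 * ℓ + 1) * E + E) := by
    intro s hs
    simp only [cheapSched, decide_eq_true_eq, Finset.mem_filter] at hs
    simp only [Finset.mem_union, Finset.mem_range, Finset.mem_Ico]
    rcases hs.2 with h | h
    · exact .inl ((Nat.div_eq_zero_iff_lt hE).1 h)
    · have := (Nat.div_eq_iff hE).1 h
      right; constructor <;> grind
  refine (Finset.card_le_card hsub).trans ((Finset.card_union_le _ _).trans ?_)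
  simp [two_mul]

theorem agentCost_cheapSched_le {E : ℕ} (hE : 1 ≤ E) {ℓ τ t : ℕ}
    (ht : t ≤ τ + (2 * ℓ + 1) * E) : agentCost E (cheapSched ℓ) τ t ≤ E := by
  have hsub : ((Finset.range (t - τ)).filter fun s => cheapSched ℓ (s / E) = true) ⊆
      Finset.range E := by
    intro s hs
    simp only [cheapSched, decide_eq_true_eq, Finset.mem_filter, Finset.mem_range] at hs
    have : s / E < 2 * ℓ + 1 := (Nat.div_lt_iff_lt_mul hE).2 (by omega)
    exact Finset.mem_range.2 ((Nat.div_eq_zero_iff_lt hE).1 (by omega))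
  exact (Finset.card_le_card hsub).trans (Finset.card_range _).le

/-- If one agent waits from before until after the other's second exploration, they meet
during that exploration. -/
theorem exists_agentPos_eq_of_waiting {V : Type*} {expl : V → ℕ → V}
    (hexpl0 : ∀ v, expl v 0 = v) {E : ℕ} (hE : 1 ≤ E)
    (hexplAll : ∀ v w : V, ∃ i ≤ E, expl v i = w) {ℓ ℓ' τ τ' : ℕ} (p p' : V)
    (h₁ : τ' + E ≤ τ + (2 * ℓ + 1) * E)
    (h₂ : τ + (2 * ℓ + 2) * E ≤ τ' + (2 * ℓ' + 1) * E) :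
    ∃ t ≤ τ + (2 * ℓ + 2) * E,
      agentPos expl E (cheapSched ℓ) p τ t = agentPos expl E (cheapSched ℓ') p' τ' t := by
  obtain ⟨i, hi, h⟩ := hexplAll (expl p E) (expl p' E)
  have hmul : (2 * ℓ + 2) * E = (2 * ℓ + 1) * E + E := by ring
  refine ⟨τ + ((2 * ℓ + 1) * E + i), by omega, ?_⟩
  rw [agentPos_of_exploring hexpl0 hE p τ (by simp [cheapSched]) hi,
    startOfPhase_cheapSched _ _ _ _ le_rfl, h,
    agentPos_cheapSched_of_waiting hexpl0 hE p' (by omega) (by omega)]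

/-- Proposition 1 (Algorithm `Cheap`): rendezvous occurs by round `(2 min(ℓ_A,ℓ_B)+3)·E`,
hence in time at most `(2L+1)·E`, and the total cost is at most `3E`. -/
theorem cheap_rendezvous {V : Type*} [Fintype V] [Nonempty V] (E : ℕ) (hE : 1 ≤ E)
    (expl : V → ℕ → V) (hexpl0 : ∀ v, expl v 0 = v)
    (hexplAll : ∀ v w : V, ∃ i ≤ E, expl v i = w)
    (L ℓA ℓB : ℕ) (hℓA : ℓA ∈ Finset.Icc 1 L) (hℓB : ℓB ∈ Finset.Icc 1 L) (hne : ℓA ≠ ℓB)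
    (pA pB : V) (hp : pA ≠ pB) (τ : ℕ) (hτ : 1 ≤ τ) :
    (∃ t, agentPos expl E (cheapSched ℓA) pA 1 t = agentPos expl E (cheapSched ℓB) pB τ t) ∧
    meetRound expl E (cheapSched ℓA) (cheapSched ℓB) pA pB 1 τ ≤ (2 * min ℓA ℓB + 3) * E ∧
    meetRound expl E (cheapSched ℓA) (cheapSched ℓB) pA pB 1 τ ≤ (2 * L + 1) * E ∧
    agentCost E (cheapSched ℓA) 1 (meetRound expl E (cheapSched ℓA) (cheapSched ℓB) pA pB 1 τ)
      + agentCost E (cheapSched ℓB) τ (meetRound expl E (cheapSched ℓA) (cheapSched ℓB) pA pB 1 τ)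
      ≤ 3 * E := by
  obtain ⟨hA1, hAL⟩ := Finset.mem_Icc.1 hℓA
  obtain ⟨hB1, hBL⟩ := Finset.mem_Icc.1 hℓB
  set m := meetRound expl E (cheapSched ℓA) (cheapSched ℓB) pA pB 1 τ
  have hmeet : ∀ t, agentPos expl E (cheapSched ℓA) pA 1 t =
      agentPos expl E (cheapSched ℓB) pB τ t → m ≤ t := fun t ht => Nat.sInf_le ht
  rcases Nat.lt_or_ge E τ with hτE | hτE
  · obtain ⟨i, hi, h⟩ := hexplAll pA pB
    have ht : agentPos expl E (cheapSched ℓA) pA 1 (1 + i) =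
        agentPos expl E (cheapSched ℓB) pB τ (1 + i) := by
      have hA := agentPos_of_exploring hexpl0 hE (T := cheapSched ℓA) (k := 0) pA 1
        (by simp [cheapSched]) hi
      rw [Nat.zero_mul, Nat.zero_add] at hA
      rw [hA, startOfPhase, h, agentPos_of_le hexpl0 _ _ _ (by omega)]
    have hmt := hmeet _ ht
    have hcA := agentCost_le_sub E (cheapSched ℓA) 1 m
    have hcB := agentCost_le_sub E (cheapSched ℓB) τ m
    have h3 : 3 * E ≤ (2 * min ℓA ℓB + 3) * E := Nat.mul_le_mul_right _ (by omega)
    have h3' : 3 * E ≤ (2 * L + 1) * E := Nat.mul_le_mul_right _ (by omega)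
    exact ⟨⟨_, ht⟩, by omega, by omega, by omega⟩
  have hmul : ∀ a, (2 * a + 3) * E = (2 * a + 2) * E + E := fun a => Nat.succ_mul _ E
  have htime : (2 * min ℓA ℓB + 3) * E ≤ (2 * L + 1) * E := Nat.mul_le_mul_right _ (by omega)
  have hA2 := agentCost_cheapSched_le_two_mul hE ℓA 1 m
  have hB2 := agentCost_cheapSched_le_two_mul hE ℓB τ m
  rcases hne.lt_or_gt with hlt | hlt
  · have h2 : 2 * E ≤ (2 * ℓA + 1) * E := Nat.mul_le_mul_right _ (by omega)
    have h3 : (2 * ℓA + 2) * E ≤ (2 * ℓB + 1) * E := Nat.mul_le_mul_right _ (by omega)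
    obtain ⟨t, htle, ht⟩ := exists_agentPos_eq_of_waiting hexpl0 hE hexplAll
      (ℓ := ℓA) (ℓ' := ℓB) (τ := 1) (τ' := τ) pA pB (by omega) (by omega)
    have hmt := hmeet t ht
    have hB := agentCost_cheapSched_le hE (ℓ := ℓB) (τ := τ) (t := m) (by omega)
    have := hmul ℓA
    rw [min_eq_left hlt.le] at htime ⊢
    exact ⟨⟨t, ht⟩, by omega, by omega, by omega⟩
  · have h2 : 1 * E ≤ (2 * ℓB + 1) * E := Nat.mul_le_mul_right _ (by omega)
    have h3 : (2 * ℓB + 3) * E ≤ (2 * ℓA + 1) * E := Nat.mul_le_mul_right _ (by omega)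
    have := hmul ℓB
    obtain ⟨t, htle, ht⟩ := exists_agentPos_eq_of_waiting hexpl0 hE hexplAll
      (ℓ := ℓB) (ℓ' := ℓA) (τ := τ) (τ' := 1) pB pA (by omega) (by omega)
    have hmt := hmeet t ht.symm
    have hA := agentCost_cheapSched_le hE (ℓ := ℓA) (τ := 1) (t := m) (by omega)
    rw [min_eq_right hlt.le] at htime ⊢
    exact ⟨⟨t, ht.symm⟩, by omega, by omega, by omega⟩
end

section
/- (Proposition 2, Algorithm Fast.) Let L ≥ 2. In the exploration model, suppose each agent with label ℓ forms S = M(ℓ) (of length m) and T = (1, S_1, S_1, S_2, S_2, …, S_m, S_m) of length 2m+1, and executes the schedule whose i-th phase is an exploration phase if T_i = 1 and a waiting phase if T_i = 0. Then for any distinct labels ℓ_A, ℓ_B ∈ {1,…,L}, any distinct starting nodes, and any delay τ ≥ 1, rendezvous is completed in time at most (4·⌊log₂(L−1)⌋ + 9)·E, and the total cost is at most (8·⌊log₂(L−1)⌋ + 18)·E. -/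
/-- The modified label `M(ℓ)`: if `c₁ … c_r` is the binary representation of `ℓ`
(most significant bit first), then `M(ℓ) = c₁c₁c₂c₂…c_rc_r01`. -/
def modLabel (ℓ : ℕ) : List Bool :=
  ((Nat.bits ℓ).reverse.flatMap fun b => [b, b]) ++ [false, true]

/-- Algorithm `Fast` for label `ℓ`: the schedule `T = (1, S₁, S₁, S₂, S₂, …, S_m, S_m)`
where `S = M(ℓ)`; phase `k` (numbered from 0) is an exploration phase iff the corresponding
entry of `T` is 1 (after `T` is exhausted, the agent waits). -/
def fastSched (ℓ : ℕ) : ℕ → Bool :=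
  fun k => if k = 0 then true else (modLabel ℓ).getD ((k - 1) / 2) false

section AgentPosition

variable {V : Type*} {expl : V → ℕ → V} {E : ℕ} {T : ℕ → Bool} {p : V} {τ : ℕ}

theorem agentPos_phase_start (hE : 1 ≤ E) (h0 : ∀ v, expl v 0 = v) (k : ℕ) :
    agentPos expl E T p τ (τ + k * E) = startOfPhase expl E T p k := by
  have h : (τ + k * E - τ) / E = k := by
    rw [Nat.add_sub_cancel_left, Nat.mul_div_cancel _ hE]
  have h' : (τ + k * E - τ) % E = 0 := by simp
  simp only [agentPos, h, h', h0, ite_self]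
  simp

theorem agentPos_of_le_wake (hE : 1 ≤ E) (h0 : ∀ v, expl v 0 = v) {t : ℕ} (ht : t ≤ τ) :
    agentPos expl E T p τ t = p := by
  rcases ht.lt_or_eq with h | rfl
  · simp [agentPos, h]
  · simpa [startOfPhase] using agentPos_phase_start (T := T) (p := p) (τ := t) hE h0 0

theorem agentPos_exploring (hE : 1 ≤ E) (h0 : ∀ v, expl v 0 = v) {k : ℕ} (hk : T k = true)
    {i : ℕ} (hi : i ≤ E) :
    agentPos expl E T p τ (τ + k * E + i) = expl (startOfPhase expl E T p k) i := by
  rcases hi.lt_or_eq with h | rfl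
  · have hdiv : (τ + k * E + i - τ) / E = k := by
      rw [add_assoc, Nat.add_sub_cancel_left, mul_comm, Nat.mul_add_div hE, Nat.div_eq_of_lt h,
        add_zero]
    have hmod : (τ + k * E + i - τ) % E = i := by
      rw [add_assoc, Nat.add_sub_cancel_left, mul_comm, Nat.mul_add_mod, Nat.mod_eq_of_lt h]
    have hlt : ¬ τ + k * E + i < τ := by omega
    simp [agentPos, hdiv, hmod, hlt, hk]
  · have h := agentPos_phase_start (T := T) (p := p) (τ := τ) hE h0 (k + 1)
    rw [add_one_mul, ← add_assoc] at h
    simp [h, startOfPhase, hk]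

theorem startOfPhase_waiting {a b : ℕ} (hab : a ≤ b) (hT : ∀ k, a ≤ k → k < b → T k = false) :
    startOfPhase expl E T p b = startOfPhase expl E T p a := by
  induction b, hab using Nat.le_induction with
  | base => rfl
  | succ b hab ih =>
    rw [startOfPhase, hT b hab b.lt_succ_self]
    simpa using ih fun k h h' => hT k h (h'.trans b.lt_succ_self)

theorem agentPos_waiting (hE : 1 ≤ E) (h0 : ∀ v, expl v 0 = v) {a b : ℕ}
    (hT : ∀ k, a ≤ k → k < b → T k = false) {t : ℕ} (ha : τ + a * E ≤ t) (hb : t ≤ τ + b * E) :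
    agentPos expl E T p τ t = startOfPhase expl E T p a := by
  have hab : a ≤ b := Nat.le_of_mul_le_mul_right (by omega : a * E ≤ b * E) hE
  rcases hb.lt_or_eq with h | rfl
  · have hka : a ≤ (t - τ) / E := (Nat.le_div_iff_mul_le hE).2 (by omega)
    have hkb : (t - τ) / E < b := (Nat.div_lt_iff_lt_mul hE).2 (by omega)
    have hlt : ¬ t < τ := by omega
    simp only [agentPos, hlt, hT _ hka hkb, if_false, Bool.false_eq_true]
    exact startOfPhase_waiting hka fun k h h' => hT k h (h'.trans hkb)
  · rw [agentPos_phase_start hE h0, startOfPhase_waiting hab hT]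

/-- An agent exploring during phase `k` meets anything that stays at `q` during that phase. -/
theorem exists_agentPos_eq_of_exploring (hE : 1 ≤ E) (h0 : ∀ v, expl v 0 = v)
    (hAll : ∀ v w : V, ∃ i ≤ E, expl v i = w) {k : ℕ} (hk : T k = true) {f : ℕ → V} {q : V}
    (hf : ∀ t, τ + k * E ≤ t → t ≤ τ + (k + 1) * E → f t = q) :
    ∃ t ≤ τ + (k + 1) * E, agentPos expl E T p τ t = f t := by
  obtain ⟨i, hi, hq⟩ := hAll (startOfPhase expl E T p k) q
  have hle : τ + k * E + i ≤ τ + (k + 1) * E := by rw [add_one_mul]; omega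
  exact ⟨_, hle, by rw [agentPos_exploring hE h0 hk hi, hq, hf _ (by omega) hle]⟩

end AgentPosition

theorem agentCost_le (E : ℕ) (T : ℕ → Bool) (τ t : ℕ) : agentCost E T τ t ≤ t :=
  (Finset.card_filter_le _ _).trans (by simp)

/-- Doubling the letters and appending `01` makes two distinct words differ at a position inside the
shorter code word; if this is its last position, both code words have a `0` just before. -/
theorem exists_getD_double_ne : ∀ {l l' : List Bool}, l ≠ l' → l.length ≤ l'.length →
    ∃ j ≤ 2 * l.length + 1,
      ((l.flatMap fun b => [b, b]) ++ [false, true]).getD j false ≠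
        ((l'.flatMap fun b => [b, b]) ++ [false, true]).getD j false ∧
      (j = 2 * l.length + 1 →
        ((l.flatMap fun b => [b, b]) ++ [false, true]).getD (j - 1) false = false ∧
          ((l'.flatMap fun b => [b, b]) ++ [false, true]).getD (j - 1) false = false)
  | [], [], hne, _ => absurd rfl hne
  | [], true :: _, _, _ => ⟨0, by simp⟩
  | [], false :: _, _, _ => ⟨1, by simp⟩
  | _ :: _, [], _, hlen => by simp at hlen
  | a :: l, b :: l', hne, hlen => by
    by_cases hab : a = b
    · obtain ⟨j, hj, hd, hlast⟩ := exists_getD_double_ne (l := l) (l' := l')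
        (fun h => hne (by rw [hab, h])) (by simpa using hlen)
      refine ⟨j + 2, by simp; omega, by simpa using hd, fun h => ?_⟩
      have hj' : j = 2 * l.length + 1 := by simp at h; omega
      subst hj'
      simpa using hlast rfl
    · exact ⟨0, by simp, by simpa using hab, by simp⟩

theorem exists_modLabel_getD_ne_of_lt {m n R : ℕ} (hmn : m < n) (hm : m < 2 ^ R) :
    ∃ j ≤ 2 * R + 1, (modLabel m).getD j false ≠ (modLabel n).getD j false ∧
      (j = 2 * R + 1 → (modLabel m).getD (j - 1) false = false ∧
        (modLabel n).getD (j - 1) false = false) := by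
  have hsize : m.bits.reverse.length ≤ R := by
    rw [List.length_reverse, Nat.size_eq_bits_len]; exact Nat.size_le.2 hm
  have hbits : m.bits.reverse ≠ n.bits.reverse := fun h =>
    hmn.ne (Nat.eq_of_testBit_eq fun i => by
      rw [Nat.testBit_eq_inth, Nat.testBit_eq_inth, List.reverse_injective h])
  obtain ⟨j, hj, hd, hlast⟩ := exists_getD_double_ne hbits (by
    simpa [Nat.size_eq_bits_len] using Nat.size_le_size hmn.le)
  exact ⟨j, by omega, hd, fun h => hlast (by omega)⟩

theorem exists_modLabel_getD_ne {L m n : ℕ} (hm : m ≤ L) (hn : n ≤ L) (hne : m ≠ n) :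
    ∃ j ≤ 2 * Nat.log 2 (L - 1) + 3, (modLabel m).getD j false ≠ (modLabel n).getD j false ∧
      (j = 2 * Nat.log 2 (L - 1) + 3 → (modLabel m).getD (j - 1) false = false ∧
        (modLabel n).getD (j - 1) false = false) := by
  have hlog : L - 1 < 2 ^ (Nat.log 2 (L - 1) + 1) := Nat.lt_pow_succ_log_self one_lt_two _
  rcases hne.lt_or_gt with h | h
  · exact exists_modLabel_getD_ne_of_lt h (R := Nat.log 2 (L - 1) + 1) (by omega)
  · obtain ⟨j, hj, hd, hlast⟩ := exists_modLabel_getD_ne_of_lt h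
      (R := Nat.log 2 (L - 1) + 1) (by omega)
    exact ⟨j, hj, hd.symm, fun h => (hlast h).symm⟩

theorem fastSched_eq_getD {l k j : ℕ} (h : 2 * j + 1 ≤ k) (h' : k < 2 * j + 3) :
    fastSched l k = (modLabel l).getD j false := by
  have hk : k ≠ 0 := by omega
  have hj : (k - 1) / 2 = j := by omega
  simp [fastSched, hk, hj]

theorem exists_fast_meeting {V : Type*} {E : ℕ} (hE : 1 ≤ E)
    {expl : V → ℕ → V} (h0 : ∀ v, expl v 0 = v) (hAll : ∀ v w : V, ∃ i ≤ E, expl v i = w)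
    {L a b : ℕ} (ha : a ≤ L) (hb : b ≤ L) (hne : a ≠ b) (pA pB : V) {τ : ℕ} (hτ : 1 ≤ τ) :
    ∃ t ≤ (4 * Nat.log 2 (L - 1) + 9) * E,
      agentPos expl E (fastSched a) pA 1 t = agentPos expl E (fastSched b) pB τ t := by
  set N := Nat.log 2 (L - 1)
  rcases Nat.lt_or_ge E τ with hlate | hearly
  · obtain ⟨t, ht, heq⟩ := exists_agentPos_eq_of_exploring (T := fastSched a) (p := pA) (τ := 1)
      (k := 0) (f := agentPos expl E (fastSched b) pB τ) hE h0 hAll rfl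
      fun t _ h => agentPos_of_le_wake hE h0 (by omega)
    exact ⟨t, by nlinarith, heq⟩
  obtain ⟨j, hj, hd, hlast⟩ := exists_modLabel_getD_ne ha hb hne
  cases hbj : (modLabel b).getD j false with
  | true =>
    have haj : (modLabel a).getD j false = false := by
      simpa only [hbj, ne_eq, Bool.not_eq_true] using hd
    obtain ⟨t, ht, heq⟩ := exists_agentPos_eq_of_exploring (T := fastSched b) (p := pB) (τ := τ)
      (k := 2 * j + 1) (f := agentPos expl E (fastSched a) pA 1) hE h0 hAll
      ((fastSched_eq_getD le_rfl (by omega)).trans hbj)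
      fun t h h' => agentPos_waiting hE h0 (a := 2 * j + 1) (b := 2 * j + 3)
        (fun k h h' => (fastSched_eq_getD h h').trans haj) (by linarith) (by nlinarith)
    exact ⟨t, by nlinarith, heq.symm⟩
  | false =>
    have haj : (modLabel a).getD j false = true := by
      simpa only [hbj, ne_eq, Bool.not_eq_false] using hd
    by_cases hjN : j = 2 * N + 3
    · obtain ⟨-, hbj'⟩ := hlast hjN
      obtain ⟨t, ht, heq⟩ := exists_agentPos_eq_of_exploring (T := fastSched a) (p := pA) (τ := 1)
        (k := 2 * j + 1) (f := agentPos expl E (fastSched b) pB τ) hE h0 hAll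
        ((fastSched_eq_getD le_rfl (by omega)).trans haj)
        fun t h h' => agentPos_waiting hE h0 (a := 2 * j) (b := 2 * j + 3)
          (fun k h h' => by
            rcases Nat.lt_or_ge k (2 * j + 1) with hk | hk
            · exact (fastSched_eq_getD (j := j - 1) (by omega) (by omega)).trans hbj'
            · exact (fastSched_eq_getD hk h').trans hbj) (by nlinarith) (by nlinarith)
      exact ⟨t, by subst hjN; nlinarith, heq⟩
    · obtain ⟨t, ht, heq⟩ := exists_agentPos_eq_of_exploring (T := fastSched a) (p := pA) (τ := 1)
        (k := 2 * j + 2) (f := agentPos expl E (fastSched b) pB τ) hE h0 hAll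
        ((fastSched_eq_getD (by omega) (by omega)).trans haj)
        fun t h h' => agentPos_waiting hE h0 (a := 2 * j + 1) (b := 2 * j + 3)
          (fun k h h' => (fastSched_eq_getD h h').trans hbj) (by nlinarith) (by nlinarith)
      have hj' : j ≤ 2 * N + 2 := by omega
      exact ⟨t, by nlinarith, heq⟩

/-- Proposition 2 (Algorithm `Fast`): rendezvous is completed in time at most
`(4⌊log₂(L−1)⌋+9)·E` and at total cost at most `(8⌊log₂(L−1)⌋+18)·E`. -/
theorem fast_rendezvous {V : Type*} [Fintype V] [Nonempty V] (E : ℕ) (hE : 1 ≤ E)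
    (expl : V → ℕ → V) (hexpl0 : ∀ v, expl v 0 = v)
    (hexplAll : ∀ v w : V, ∃ i ≤ E, expl v i = w)
    (L : ℕ) (hL : 2 ≤ L)
    (ℓA ℓB : ℕ) (hℓA : ℓA ∈ Finset.Icc 1 L) (hℓB : ℓB ∈ Finset.Icc 1 L) (hne : ℓA ≠ ℓB)
    (pA pB : V) (hp : pA ≠ pB) (τ : ℕ) (hτ : 1 ≤ τ) :
    (∃ t, agentPos expl E (fastSched ℓA) pA 1 t = agentPos expl E (fastSched ℓB) pB τ t) ∧
    meetRound expl E (fastSched ℓA) (fastSched ℓB) pA pB 1 τ ≤ (4 * Nat.log 2 (L - 1) + 9) * E ∧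
    agentCost E (fastSched ℓA) 1 (meetRound expl E (fastSched ℓA) (fastSched ℓB) pA pB 1 τ)
      + agentCost E (fastSched ℓB) τ (meetRound expl E (fastSched ℓA) (fastSched ℓB) pA pB 1 τ)
      ≤ (8 * Nat.log 2 (L - 1) + 18) * E := by
  obtain ⟨t, ht, heq⟩ := exists_fast_meeting hE hexpl0 hexplAll (Finset.mem_Icc.1 hℓA).2
    (Finset.mem_Icc.1 hℓB).2 hne pA pB hτ
  have hmeet : meetRound expl E (fastSched ℓA) (fastSched ℓB) pA pB 1 τ ≤
      (4 * Nat.log 2 (L - 1) + 9) * E := (Nat.sInf_le heq).trans ht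
  refine ⟨⟨t, heq⟩, hmeet, (add_le_add (agentCost_le _ _ _ _) (agentCost_le _ _ _ _)).trans ?_⟩
  linarith
end

section
/- (Theorem 1.) Let n ≥ 3, L ≥ 4, E = n − 1, F = ⌈E/2⌉, and let φ ≥ 0 be an integer with 3φ < F. Suppose a rendezvous algorithm for label space {1,…,L} on the oriented ring of size n with simultaneous start solves rendezvous, and every execution with distinct labels and distinct starting nodes has cost at most E + φ. Then there exist distinct labels x, y ∈ {1,…,L} and distinct starting nodes p_x, p_y such that the meeting time of the corresponding execution is at least (⌊L/2⌋ − 1)·(F − 3φ)/2. -/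
/-- Position at the end of round `t` of an agent with behaviour vector `Vv` starting at node
`p` of the oriented ring of size `n` (rounds are numbered `1, 2, …`). -/
def ringPos (n : ℕ) (Vv : ℕ → ℤ) (p : ZMod n) (t : ℕ) : ZMod n :=
  p + ((∑ j ∈ Finset.Icc 1 t, Vv j : ℤ) : ZMod n)

/-- The meeting time of the execution in which the agents with behaviour vectors `Vx`, `Vy`
start at nodes `p`, `q`: the least `t` at which their positions coincide. -/
noncomputable def ringMeetTime (n : ℕ) (Vx Vy : ℕ → ℤ) (p q : ZMod n) : ℕ :=
  sInf {t | ringPos n Vx p t = ringPos n Vy q t}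

/-- The cost of the execution: the number of pairs `(z, j)` with `z` one of the two agents,
`1 ≤ j ≤ T` (`T` the meeting time) and agent `z` moving in round `j`. -/
noncomputable def ringExecCost (n : ℕ) (Vx Vy : ℕ → ℤ) (p q : ZMod n) : ℕ :=
  ((Finset.Icc 1 (ringMeetTime n Vx Vy p q)).filter fun j => Vx j ≠ 0).card +
    ((Finset.Icc 1 (ringMeetTime n Vx Vy p q)).filter fun j => Vy j ≠ 0).card

open Finset

/-- The number of rounds `j ∈ {1, …, t}` in which the vector `V` takes the value `s`. -/
def stepCount (V : ℕ → ℤ) (s : ℤ) (t : ℕ) : ℕ := #{j ∈ Icc 1 t | V j = s}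

lemma stepCount_mono (V : ℕ → ℤ) (s : ℤ) : Monotone (stepCount V s) := fun _ _ h =>
  card_le_card (filter_subset_filter _ (Icc_subset_Icc_right h))

lemma stepCount_zero (V : ℕ → ℤ) (s : ℤ) : stepCount V s 0 = 0 := by simp [stepCount]

lemma stepCount_succ (V : ℕ → ℤ) (s : ℤ) (t : ℕ) :
    stepCount V s (t + 1) = stepCount V s t + if V (t + 1) = s then 1 else 0 := by
  unfold stepCount
  rw [← insert_Icc_right_eq_Icc_add_one (by omega), filter_insert]
  split_ifs <;> simp

lemma stepCount_add_stepCount_succ_le (V : ℕ → ℤ) (t : ℕ) :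
    stepCount V 1 (t + 1) + stepCount V (-1) (t + 1) ≤
      stepCount V 1 t + stepCount V (-1) t + 1 := by
  rw [stepCount_succ, stepCount_succ]
  split_ifs <;> omega

lemma sum_eq_stepCount_sub_stepCount {V : ℕ → ℤ}
    (hV : ∀ j, 1 ≤ j → V j = -1 ∨ V j = 0 ∨ V j = 1) (t : ℕ) :
    ∑ j ∈ Icc 1 t, V j = (stepCount V 1 t : ℤ) - stepCount V (-1) t := by
  induction t with
  | zero => simp [stepCount_zero]
  | succ t ih =>
    rw [sum_Icc_succ_top (by omega), ih, stepCount_succ, stepCount_succ]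
    rcases hV (t + 1) (by omega) with h | h | h <;> simp [h] <;> ring

lemma card_filter_ne_zero_eq {V : ℕ → ℤ}
    (hV : ∀ j, 1 ≤ j → V j = -1 ∨ V j = 0 ∨ V j = 1) (t : ℕ) :
    #{j ∈ Icc 1 t | V j ≠ 0} = stepCount V 1 t + stepCount V (-1) t := by
  unfold stepCount
  rw [← card_union_of_disjoint, ← filter_or]
  · congr 1
    refine filter_congr fun j hj => ?_
    rcases hV j (mem_Icc.1 hj).1 with h | h | h <;> simp [h]
  · refine disjoint_filter.2 fun j _ h => ?_
    simp [h]

/-- An integer sequence that hits every residue modulo `n` has range of width at least `n - 1`. -/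
lemma exists_le_sub_of_forall_residue {n : ℕ} [NeZero n] {D : ℕ → ℤ} {T : ℕ}
    (h : ∀ d : ZMod n, ∃ t ≤ T, (D t : ZMod n) = d) :
    ∃ s ≤ T, ∃ t ≤ T, (n : ℤ) ≤ D t - D s + 1 := by
  obtain ⟨s, hs, hmin⟩ := exists_min_image (range (T + 1)) D ⟨0, by simp⟩
  obtain ⟨t, ht, hmax⟩ := exists_max_image (range (T + 1)) D ⟨0, by simp⟩
  refine ⟨s, by simpa [Nat.lt_succ_iff] using hs, t, by simpa [Nat.lt_succ_iff] using ht, ?_⟩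
  have hsub : (univ : Finset (ZMod n)) ⊆ (Icc (D s) (D t)).image (fun z : ℤ => (z : ZMod n)) := by
    intro d _
    obtain ⟨u, hu, hd⟩ := h d
    have hu' : u ∈ range (T + 1) := mem_range.2 (by omega)
    exact mem_image.2 ⟨D u, mem_Icc.2 ⟨hmin u hu', hmax u hu'⟩, hd⟩
  have hcard := (card_le_card hsub).trans card_image_le
  rw [card_univ, ZMod.card, Int.card_Icc] at hcard
  have := hmin t ht
  omega

/-- The largest meeting time over all executions of two behaviour vectors with distinct
starting nodes. -/
noncomputable def worstMeetTime (n : ℕ) [NeZero n] (V W : ℕ → ℤ) : ℕ :=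
  (univ : Finset (ZMod n)).offDiag.sup fun pq => ringMeetTime n V W pq.1 pq.2

lemma ringMeetTime_le_worstMeetTime {n : ℕ} [NeZero n] (V W : ℕ → ℤ) {p q : ZMod n}
    (h : p ≠ q) : ringMeetTime n V W p q ≤ worstMeetTime n V W :=
  le_sup (s := univ.offDiag) (f := fun pq : ZMod n × ZMod n => ringMeetTime n V W pq.1 pq.2)
    (b := (p, q)) (by simpa using h)

lemma ringMeetTime_comm (n : ℕ) (V W : ℕ → ℤ) (p q : ZMod n) :
    ringMeetTime n V W p q = ringMeetTime n W V q p := by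
  simp only [ringMeetTime, eq_comm]

lemma worstMeetTime_comm (n : ℕ) [NeZero n] (V W : ℕ → ℤ) :
    worstMeetTime n V W = worstMeetTime n W V := by
  have key : ∀ V W, worstMeetTime n V W ≤ worstMeetTime n W V := by
    refine fun V W => Finset.sup_le fun pq hpq => ?_
    rw [ringMeetTime_comm]
    exact ringMeetTime_le_worstMeetTime W V (by simpa [eq_comm] using hpq)
  exact le_antisymm (key V W) (key W V)

lemma exists_ringMeetTime_eq_worstMeetTime {n : ℕ} [NeZero n] (hn : 2 ≤ n) (V W : ℕ → ℤ) :
    ∃ p q : ZMod n, p ≠ q ∧ ringMeetTime n V W p q = worstMeetTime n V W := by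
  have : Fact (1 < n) := ⟨hn⟩
  obtain ⟨pq, hpq, h⟩ := exists_mem_eq_sup (univ : Finset (ZMod n)).offDiag
    ⟨(0, 1), by simp⟩ (fun pq => ringMeetTime n V W pq.1 pq.2)
  exact ⟨pq.1, pq.2, by simpa using hpq, h.symm⟩

/-- If two agents always meet at cost at most `n - 1 + φ`, then up to their worst meeting time
one of them moves essentially clockwise and the other one essentially counterclockwise. -/
lemma stepCount_dichotomy {n φ : ℕ} [NeZero n] (hn : 2 ≤ n) {V W : ℕ → ℤ}
    (hV : ∀ j, 1 ≤ j → V j = -1 ∨ V j = 0 ∨ V j = 1)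
    (hW : ∀ j, 1 ≤ j → W j = -1 ∨ W j = 0 ∨ W j = 1)
    (hsolve : ∀ p q : ZMod n, p ≠ q → ∃ t, ringPos n V p t = ringPos n W q t)
    (hcost : ∀ p q : ZMod n, p ≠ q → ringExecCost n V W p q ≤ n - 1 + φ) :
    (n - 1 ≤ stepCount V 1 (worstMeetTime n V W) + stepCount W (-1) (worstMeetTime n V W) ∧
      stepCount V (-1) (worstMeetTime n V W) + stepCount W 1 (worstMeetTime n V W) ≤ φ) ∨
    (n - 1 ≤ stepCount W 1 (worstMeetTime n V W) + stepCount V (-1) (worstMeetTime n V W) ∧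
      stepCount W (-1) (worstMeetTime n V W) + stepCount V 1 (worstMeetTime n V W) ≤ φ) := by
  set T := worstMeetTime n V W with hT
  obtain ⟨p, q, hpq, hmeet⟩ := exists_ringMeetTime_eq_worstMeetTime hn V W
  have hc := hcost p q hpq
  rw [ringExecCost, hmeet, ← hT, card_filter_ne_zero_eq hV, card_filter_ne_zero_eq hW] at hc
  obtain ⟨s, hs, t, ht, hst⟩ := exists_le_sub_of_forall_residue (n := n) (T := T)
    (D := fun t => ∑ j ∈ Icc 1 t, V j - ∑ j ∈ Icc 1 t, W j) (by
      intro d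
      by_cases hd : d = 0
      · exact ⟨0, Nat.zero_le _, by simp [hd]⟩
      · have hmem := Nat.sInf_mem (s := {t | ringPos n V 0 t = ringPos n W d t})
          (hsolve 0 d (Ne.symm hd))
        refine ⟨_, ringMeetTime_le_worstMeetTime V W (Ne.symm hd), ?_⟩
        have hmem' : ringPos n V 0 (ringMeetTime n V W 0 d) =
            ringPos n W d (ringMeetTime n V W 0 d) := hmem
        simp only [ringPos, zero_add] at hmem'
        rw [Int.cast_sub, hmem', add_sub_cancel_right])
  simp only [sum_eq_stepCount_sub_stepCount hV, sum_eq_stepCount_sub_stepCount hW] at hst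
  have hVp := stepCount_mono V 1
  have hVn := stepCount_mono V (-1)
  have hWp := stepCount_mono W 1
  have hWn := stepCount_mono W (-1)
  have := hVp hs; have := hVp ht; have := hVn hs; have := hVn ht
  have := hWp hs; have := hWp ht; have := hWn hs; have := hWn ht
  rcases le_total s t with h | h
  · left
    have := hVp h; have := hVn h; have := hWp h; have := hWn h
    omega
  · right
    have := hVp h; have := hVn h; have := hWp h; have := hWn h
    omega

/-- Agents that all essentially move in the same direction have to move one after the other.
Here `P x t` and `N x t` count the moves of agent `x` up to round `t` in the preferred and in the
other direction, and `T x y` is the time by which `x` and `y` are done with each other. -/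
lemma exists_long_time_of_same_direction {ι : Type*} {P N : ι → ℕ → ℕ}
    {T : ι → ι → ℕ} {E φ : ℕ} {S : Finset ι} (hφ : 3 * φ < E)
    (hP : ∀ x, Monotone (P x)) (hN : ∀ x, Monotone (N x))
    (h0 : ∀ x, P x 0 + N x 0 = 0)
    (hstep : ∀ x t, P x (t + 1) + N x (t + 1) ≤ P x t + N x t + 1)
    (hcomm : ∀ x y, T x y = T y x)
    (hpair : ∀ x ∈ S, ∀ y ∈ S, x ≠ y →
      (E ≤ P x (T x y) + N y (T x y) ∧ N x (T x y) + P y (T x y) ≤ φ) ∨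
      (E ≤ P y (T x y) + N x (T x y) ∧ N y (T x y) + P x (T x y) ≤ φ))
    (hdir : ∀ x ∈ S, ∀ y ∈ S, x ≠ y → N x (T x y) ≤ φ) (hS : 2 ≤ #S) :
    ∃ x ∈ S, ∃ y ∈ S, x ≠ y ∧ (#S - 1) * (E - 3 * φ) ≤ T x y := by
  classical
  by_contra! hcon
  set M : ι → ℕ → ℕ := fun x t => P x t + N x t with hM
  have hMmono : ∀ x, Monotone (M x) := fun x => (hP x).add (hN x)
  have hlip : ∀ x s d, M x (s + d) ≤ M x s + d := by
    intro x s d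
    induction d with
    | zero => simp
    | succ d ih => have := hstep x (s + d); simp only [hM] at *; grind
  let τ : ι → ℕ := fun x => sInf {t | E - φ ≤ M x t}
  let win : ι → ι → Prop := fun x y => E - φ ≤ M x (T x y) ∧ M y (T x y) ≤ 2 * φ
  have hwin : ∀ x ∈ S, ∀ y ∈ S, x ≠ y → win x y ∨ win y x := by
    intro x hx y hy hxy
    have h1 := hdir x hx y hy hxy
    have h2 := hdir y hy x hx hxy.symm
    rw [hcomm y x] at h2
    simp only [win, hM, hcomm y x]
    rcases hpair x hx y hy hxy with h | h <;> omega
  have hτ : ∀ {x y}, win x y → E - φ ≤ M x (τ x) ∧ τ x ≤ T x y := fun {x y} h =>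
    ⟨Nat.sInf_mem (s := {t | E - φ ≤ M x t}) ⟨_, h.1⟩, Nat.sInf_le h.1⟩
  have hsep : ∀ {x y z}, win x y → win y z → τ x + (E - 3 * φ) ≤ τ y := by
    intro x y z hxy hyz
    have h1 := hMmono y (hτ hxy).2
    have h2 := (hτ hyz).1
    have h3 := hxy.2
    have hle : τ x ≤ τ y := by
      by_contra! hlt
      have := hMmono y hlt.le
      omega
    obtain ⟨d, hd⟩ := Nat.exists_eq_add_of_le hle
    have := hlip y (τ x) d
    rw [← hd] at this
    omega
  obtain ⟨l, hl, hlose⟩ : ∃ l ∈ S, ∀ x ∈ S.erase l, ∃ y ∈ S, x ≠ y ∧ win x y := by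
    by_cases hall : ∀ x ∈ S, ∃ y ∈ S, x ≠ y ∧ win x y
    · obtain ⟨l, hl⟩ := card_pos.1 (by omega : 0 < #S)
      exact ⟨l, hl, fun x hx => hall x (mem_of_mem_erase hx)⟩
    · push Not at hall
      obtain ⟨l, hl, hno⟩ := hall
      refine ⟨l, hl, fun x hx => ?_⟩
      obtain ⟨hxl, hx⟩ := mem_erase.1 hx
      exact ⟨l, hl, hxl, (hwin x hx l hl hxl).resolve_right (hno x hx hxl.symm)⟩
  have hg : 0 < E - 3 * φ := by omega
  obtain ⟨x, hx, y, hy, hxy, heq⟩ := exists_ne_map_eq_of_card_lt_of_maps_to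
    (s := S.erase l) (t := Icc 1 (#S - 2)) (f := fun x => τ x / (E - 3 * φ))
    (by rw [card_erase_of_mem hl, Nat.card_Icc]; omega) (by
      intro x hx
      obtain ⟨y, hy, hxy, hw⟩ := hlose x hx
      have h1 := (hτ hw).1
      have h2 := hlip x 0 (τ x)
      have h3 : M x 0 = 0 := h0 x
      rw [zero_add] at h2
      have h4 := (hτ hw).2.trans_lt (hcon x (mem_of_mem_erase hx) y hy hxy)
      have h5 := (Nat.div_lt_iff_lt_mul hg).2 h4
      have h6 := (Nat.one_le_div_iff hg).2 (by omega : E - 3 * φ ≤ τ x)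
      exact mem_coe.2 (mem_Icc.2 ⟨h6, (Nat.le_sub_one_of_lt h5).trans_eq (Nat.sub_sub _ _ _)⟩))
  have hne : ∀ {a b c}, win a b → win b c → τ a / (E - 3 * φ) ≠ τ b / (E - 3 * φ) := by
    intro a b c hab hbc h
    have := Nat.div_le_div_right (c := E - 3 * φ) (hsep hab hbc)
    rw [Nat.add_div_right _ hg] at this
    omega
  obtain ⟨y', -, -, hwx⟩ := hlose x hx
  obtain ⟨x', -, -, hwy⟩ := hlose y hy
  rcases hwin x (mem_of_mem_erase hx) y (mem_of_mem_erase hy) hxy with h | h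
  · exact hne h hwy heq
  · exact hne h hwx heq.symm

/-- Theorem 1: if a rendezvous algorithm on the oriented ring of size `n` with simultaneous
start always has cost at most `E + φ` (where `E = n − 1`, `F = ⌈E/2⌉` and `3φ < F`), then some
execution has meeting time at least `(⌊L/2⌋ − 1)·(F − 3φ)/2`. -/
theorem cheap_cost_implies_long_time (n L E F φ : ℕ) (hn : 3 ≤ n) (hL : 4 ≤ L)
    (hE : E = n - 1) (hF : F = (E + 1) / 2) (hφ : 3 * φ < F)
    (A : ℕ → ℕ → ℤ)
    (hA : ∀ x ∈ Finset.Icc 1 L, ∀ j, 1 ≤ j → A x j = -1 ∨ A x j = 0 ∨ A x j = 1)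
    (hsolve : ∀ x ∈ Finset.Icc 1 L, ∀ y ∈ Finset.Icc 1 L, x ≠ y →
      ∀ p q : ZMod n, p ≠ q → ∃ t, ringPos n (A x) p t = ringPos n (A y) q t)
    (hcost : ∀ x ∈ Finset.Icc 1 L, ∀ y ∈ Finset.Icc 1 L, x ≠ y →
      ∀ p q : ZMod n, p ≠ q → ringExecCost n (A x) (A y) p q ≤ E + φ) :
    ∃ x ∈ Finset.Icc 1 L, ∃ y ∈ Finset.Icc 1 L, x ≠ y ∧ ∃ p q : ZMod n, p ≠ q ∧
      (((L / 2 : ℕ) : ℝ) - 1) * (((F : ℝ) - 3 * (φ : ℝ)) / 2)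
        ≤ (ringMeetTime n (A x) (A y) p q : ℝ) := by
  have : NeZero n := ⟨by omega⟩
  subst hE
  set I := Icc 1 L with hI
  set T : ℕ → ℕ → ℕ := fun x y => worstMeetTime n (A x) (A y) with hT
  have hcomm : ∀ x y, T x y = T y x := fun x y => worstMeetTime_comm n _ _
  have hpair := fun x (hx : x ∈ I) y (hy : y ∈ I) (hxy : x ≠ y) =>
    stepCount_dichotomy (by omega) (hA x hx) (hA y hy) (hsolve x hx y hy hxy)
      (hcost x hx y hy hxy)
  have hcardI : #I = L := by simp [hI]
  have hdir : ∀ x ∈ I, (∀ y ∈ I, x ≠ y → stepCount (A x) (-1) (T x y) ≤ φ) ∨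
      (∀ y ∈ I, x ≠ y → stepCount (A x) 1 (T x y) ≤ φ) := by
    intro x hx
    obtain ⟨z, hz, hmax⟩ := exists_max_image (I.erase x) (T x)
      (card_pos.1 (by rw [card_erase_of_mem hx]; omega))
    obtain ⟨hzx, hz⟩ := mem_erase.1 hz
    have hle : ∀ y ∈ I, x ≠ y → T x y ≤ T x z := fun y hy hxy =>
      hmax y (mem_erase.2 ⟨hxy.symm, hy⟩)
    rcases hpair x hx z hz hzx.symm with h | h
    · left
      exact fun y hy hxy => (stepCount_mono _ _ (hle y hy hxy)).trans (by simp only [hT]; omega)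
    · right
      exact fun y hy hxy => (stepCount_mono _ _ (hle y hy hxy)).trans (by simp only [hT]; omega)
  have finish : ∀ S ⊆ I, L / 2 ≤ #S →
      (∃ x ∈ S, ∃ y ∈ S, x ≠ y ∧ (#S - 1) * (n - 1 - 3 * φ) ≤ T x y) →
      ∃ x ∈ I, ∃ y ∈ I, x ≠ y ∧ ∃ p q : ZMod n, p ≠ q ∧
        (((L / 2 : ℕ) : ℝ) - 1) * (((F : ℝ) - 3 * (φ : ℝ)) / 2)
          ≤ (ringMeetTime n (A x) (A y) p q : ℝ) := by
    rintro S hSI hS ⟨x, hx, y, hy, hxy, hle⟩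
    obtain ⟨p, q, hpq, hmeet⟩ :=
      exists_ringMeetTime_eq_worstMeetTime (n := n) (by omega) (A x) (A y)
    refine ⟨x, hSI hx, y, hSI hy, hxy, p, q, hpq, ?_⟩
    rw [hmeet]
    have hmul : (L / 2 - 1) * (F - 3 * φ) ≤ T x y :=
      (Nat.mul_le_mul (by omega) (by omega)).trans hle
    have hreal : (((L / 2 : ℕ) : ℝ) - 1) * ((F : ℝ) - 3 * (φ : ℝ)) ≤ (T x y : ℝ) := by
      have := (Nat.cast_le (α := ℝ)).2 hmul
      rw [Nat.cast_mul, Nat.cast_sub (by omega), Nat.cast_sub hφ.le] at this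
      exact_mod_cast this
    have : (0 : ℝ) ≤ T x y := Nat.cast_nonneg _
    change _ ≤ (T x y : ℝ)
    linarith
  classical
  set C := I.filter fun x => ∀ y ∈ I, x ≠ y → stepCount (A x) (-1) (T x y) ≤ φ with hC
  by_cases hcard : L / 2 ≤ #C
  · refine finish C (filter_subset _ _) hcard (exists_long_time_of_same_direction
      (P := fun x => stepCount (A x) 1) (N := fun x => stepCount (A x) (-1)) (by omega)
      (fun x => stepCount_mono _ _) (fun x => stepCount_mono _ _)
      (fun x => by simp [stepCount_zero]) (fun x => stepCount_add_stepCount_succ_le (A x)) hcomm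
      (fun x hx y hy => hpair x (mem_filter.1 hx).1 y (mem_filter.1 hy).1)
      (fun x hx y hy => (mem_filter.1 hx).2 y (mem_filter.1 hy).1) (by omega))
  · have hcard' : L / 2 ≤ #(I \ C) := by
      have := le_card_sdiff C I
      omega
    have hmem : ∀ x ∈ I \ C, x ∈ I ∧ ∀ y ∈ I, x ≠ y → stepCount (A x) 1 (T x y) ≤ φ := by
      intro x hx
      obtain ⟨hxI, hxC⟩ := mem_sdiff.1 hx
      exact ⟨hxI, (hdir x hxI).resolve_left fun h => hxC (mem_filter.2 ⟨hxI, h⟩)⟩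
    refine finish (I \ C) sdiff_subset hcard' (exists_long_time_of_same_direction
      (P := fun x => stepCount (A x) (-1)) (N := fun x => stepCount (A x) 1) (by omega)
      (fun x => stepCount_mono _ _) (fun x => stepCount_mono _ _)
      (fun x => by simp [stepCount_zero])
      (fun x t => by have := stepCount_add_stepCount_succ_le (A x) t; omega) hcomm
      (fun x hx y hy hxy => ?_)
      (fun x hx y hy => (hmem x hx).2 y (hmem y hy).1) (by omega))
    have := hpair x (hmem x hx).1 y (hmem y hy).1 hxy
    simp only [hT]
    omega
end

section
/- (Theorem 2.) For every real c > 0 there exist a real γ > 0 and an integer L₀ such that the following holds for every integer L ≥ L₀ and every positive multiple n of 6: if a rendezvous algorithm for label space {1,…,L} on the oriented ring of size n with simultaneous start solves rendezvous, and every execution with distinct labels and distinct starting nodes has meeting time at most c·E·log₂ L (where E = n − 1), then some execution with distinct labels and distinct starting nodes has cost at least γ·E·log₂ L. -/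
/-- A walk `f` whose `i`-th displacement is at most `w i ≤ δ` can be tracked to within `δ` by a
walk with steps `δ * u i`, `u i ∈ {-1, 0, 1}`, of total length at most `∑ w`. -/
lemma exists_coarse_walk {δ : ℤ} (hδ : 0 < δ) (f w : ℕ → ℤ) (hf : f 0 = 0)
    (hfw : ∀ i, |f (i + 1) - f i| ≤ w i) (hw : ∀ i, w i ≤ δ) :
    ∃ u : ℕ → ℤ, (∀ i, u i ∈ ({-1, 0, 1} : Finset ℤ)) ∧ ∀ i,
      |f i - δ * ∑ j ∈ Finset.range i, u j| < δ ∧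
        δ * ∑ j ∈ Finset.range i, |u j| ≤ ∑ j ∈ Finset.range i, w j := by
  let s : ℤ → ℤ := fun e => if δ ≤ e then 1 else if e ≤ -δ then -1 else 0
  obtain ⟨q, hq0, hq⟩ : ∃ q : ℕ → ℤ, q 0 = 0 ∧ ∀ i, q (i + 1) = q i + s (f (i + 1) - δ * q i) :=
    ⟨fun i => Nat.rec 0 (fun i r => r + s (f (i + 1) - δ * r)) i, rfl, fun _ => rfl⟩
  refine ⟨fun i => s (f (i + 1) - δ * q i), fun i => ?_, fun i => ?_⟩
  · simp only [s]
    split_ifs <;> simp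
  have hsum : ∀ i, ∑ j ∈ Finset.range i, s (f (j + 1) - δ * q j) = q i := by
    intro i
    induction i with
    | zero => simp [hq0]
    | succ i ih => rw [Finset.sum_range_succ, ih, hq]
  have key : |f i - δ * q i| < δ ∧
      |f i - δ * q i| + δ * ∑ j ∈ Finset.range i, |s (f (j + 1) - δ * q j)|
        ≤ ∑ j ∈ Finset.range i, w j := by
    induction i with
    | zero => simpa [hq0, hf] using hδ
    | succ i ih =>
      rw [Finset.sum_range_succ, Finset.sum_range_succ, hq, mul_add, mul_add]
      obtain ⟨h₁, h₂⟩ := ih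
      have h₃ := hfw i
      have h₄ := hw i
      generalize δ * ∑ j ∈ Finset.range i, |s (f (j + 1) - δ * q j)| = X at *
      generalize δ * q i = Y at *
      simp only [s]
      split_ifs <;> simp <;> grind
  rw [hsum]
  exact ⟨key.1, by linarith [key.2, abs_nonneg (f i - δ * q i)]⟩

lemma abs_sum_Icc_sub_le (W : ℕ → ℤ) {a b : ℕ} (hab : a ≤ b) :
    |∑ j ∈ Finset.Icc 1 b, W j - ∑ j ∈ Finset.Icc 1 a, W j|
      ≤ ∑ j ∈ Finset.Icc 1 b, |W j| - ∑ j ∈ Finset.Icc 1 a, |W j| := by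
  induction b, hab using Nat.le_induction with
  | base => simp
  | succ b _ ih =>
    rw [Finset.sum_Icc_succ_top (by omega), Finset.sum_Icc_succ_top (by omega)]
    grind

lemma sum_Icc_abs_sub_le (W : ℕ → ℤ) (hW : ∀ j, 1 ≤ j → |W j| ≤ 1) {a b : ℕ} (hab : a ≤ b) :
    ∑ j ∈ Finset.Icc 1 b, |W j| - ∑ j ∈ Finset.Icc 1 a, |W j| ≤ (b - a : ℤ) := by
  induction b, hab using Nat.le_induction with
  | base => simp
  | succ b _ ih =>
    rw [Finset.sum_Icc_succ_top (by omega)]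
    have := hW (b + 1) (by omega)
    push_cast
    linarith

/-- A behaviour vector can be stopped so that it makes at most `C` moves in total, without
changing the rounds before the budget `C` is exhausted. -/
lemma exists_truncation (V : ℕ → ℤ) (hV : ∀ j, 1 ≤ j → |V j| ≤ 1) {C : ℝ} (hC : 0 ≤ C) :
    ∃ W : ℕ → ℤ, (∀ j, 1 ≤ j → |W j| ≤ 1) ∧
      (∀ t, ((∑ j ∈ Finset.Icc 1 t, |W j| : ℤ) : ℝ) ≤ C) ∧
      ∀ t, (((Finset.Icc 1 t).filter fun j => V j ≠ 0).card : ℝ) ≤ C →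
        ∑ j ∈ Finset.Icc 1 t, W j = ∑ j ∈ Finset.Icc 1 t, V j := by
  classical
  let W : ℕ → ℤ := fun j =>
    if (((Finset.Icc 1 j).filter fun j => V j ≠ 0).card : ℝ) ≤ C then V j else 0
  have hWV : ∀ j, |W j| ≤ |V j| := by
    intro j
    simp only [W]
    split_ifs <;> simp
  refine ⟨W, fun j hj => (hWV j).trans (hV j hj), fun t => ?_, fun t ht => ?_⟩
  · have hle : ∀ t, ∑ j ∈ Finset.Icc 1 t, |W j|
        ≤ ((Finset.Icc 1 t).filter fun j => V j ≠ 0).card := by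
      intro t
      rw [Finset.card_filter, Nat.cast_sum]
      refine Finset.sum_le_sum fun j hj => (hWV j).trans ?_
      have := hV j (Finset.mem_Icc.1 hj).1
      by_cases h : V j = 0 <;> simp [h, this]
    induction t with
    | zero => simpa using hC
    | succ t ih =>
      by_cases h : (((Finset.Icc 1 (t + 1)).filter fun j => V j ≠ 0).card : ℝ) ≤ C
      · exact le_trans (by exact_mod_cast hle (t + 1)) h
      · have : W (t + 1) = 0 := if_neg h
        rw [Finset.sum_Icc_succ_top (by omega), this]
        simpa using ih
  · refine Finset.sum_congr rfl fun j hj => if_pos (le_trans ?_ ht)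
    exact_mod_cast Finset.card_le_card
      (Finset.filter_subset_filter _ (Finset.Icc_subset_Icc_right (Finset.mem_Icc.1 hj).2))

/-- As long as an agent has made at most `C` moves, its position is determined up to `2 (δ - 1)`
by a sequence of signs, one for every `δ` rounds, with at most `C / δ` nonzero terms. -/
lemma exists_sparse_code (V : ℕ → ℤ) (hV : ∀ j, 1 ≤ j → |V j| ≤ 1) {C : ℝ} (hC : 0 ≤ C)
    {δ : ℕ} (hδ : 0 < δ) :
    ∃ u : ℕ → ℤ, (∀ i, u i ∈ ({-1, 0, 1} : Finset ℤ)) ∧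
      (∀ k, (δ : ℝ) * ((∑ i ∈ Finset.range k, |u i| : ℤ) : ℝ) ≤ C) ∧
      ∀ t, (((Finset.Icc 1 t).filter fun j => V j ≠ 0).card : ℝ) ≤ C →
        |∑ j ∈ Finset.Icc 1 t, V j - δ * ∑ i ∈ Finset.range (t / δ), u i| ≤ 2 * ((δ : ℤ) - 1) := by
  obtain ⟨W, hW, hWC, hWV⟩ := exists_truncation V hV hC
  have hstep : ∀ i, i * δ ≤ (i + 1) * δ := fun i => Nat.mul_le_mul_right _ (by omega)
  obtain ⟨u, hu, hu'⟩ := exists_coarse_walk (δ := δ) (by exact_mod_cast hδ)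
    (fun i => ∑ j ∈ Finset.Icc 1 (i * δ), W j)
    (fun i => ∑ j ∈ Finset.Icc 1 ((i + 1) * δ), |W j| - ∑ j ∈ Finset.Icc 1 (i * δ), |W j|)
    (by simp) (fun i => abs_sum_Icc_sub_le W (hstep i))
    (fun i => (sum_Icc_abs_sub_le W hW (hstep i)).trans (by push_cast; linarith))
  refine ⟨u, hu, fun k => ?_, fun t ht => ?_⟩
  · have h := (hu' k).2
    rw [Finset.sum_range_sub (fun i => ∑ j ∈ Finset.Icc 1 (i * δ), |W j|)] at h
    simp only [zero_mul, Finset.Icc_eq_empty_of_lt Nat.zero_lt_one, Finset.sum_empty,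
      sub_zero] at h
    exact le_trans (by exact_mod_cast h) (hWC (k * δ))
  · rw [← hWV t ht]
    have h₁ := (hu' (t / δ)).1
    have h₂ := abs_sum_Icc_sub_le W (Nat.div_mul_le_self t δ)
    have h₃ := sum_Icc_abs_sub_le W hW (Nat.div_mul_le_self t δ)
    have h₄ : (t : ℤ) - (t / δ * δ : ℕ) ≤ δ - 1 := by
      have := Nat.div_add_mod' t δ
      have := Nat.mod_lt t hδ
      omega
    grind

/-- A Chernoff-type bound on the number of sign vectors of length `M` with at most `K` nonzero
entries. -/
lemma card_le_of_sparse_codes {ι : Type*} (s : Finset ι) (M : ℕ) (code : ι → Fin M → ℤ)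
    (hinj : Set.InjOn code s) (hcode : ∀ x ∈ s, ∀ i, code x i ∈ ({-1, 0, 1} : Finset ℤ))
    {a K : ℝ} (ha : 0 ≤ a) (hK : ∀ x ∈ s, ((∑ i, |code x i| : ℤ) : ℝ) ≤ K) :
    (s.card : ℝ) ≤ Real.exp (a * K + 2 * Real.exp (-a) * M) := by
  have hlow : (s.card : ℝ) * Real.exp (-(a * K))
      ≤ ∑ x ∈ s, ∏ i, Real.exp (-(a * (|code x i| : ℤ))) := by
    rw [← nsmul_eq_mul]
    refine Finset.card_nsmul_le_sum _ _ _ fun x hx => ?_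
    rw [← Real.exp_sum, Finset.sum_neg_distrib, ← Finset.mul_sum]
    have := mul_le_mul_of_nonneg_left (hK x hx) ha
    push_cast at this ⊢
    exact Real.exp_le_exp.2 (by linarith)
  have hup : ∑ x ∈ s, ∏ i, Real.exp (-(a * (|code x i| : ℤ)))
      ≤ (1 + 2 * Real.exp (-a)) ^ M := by
    calc ∑ x ∈ s, ∏ i, Real.exp (-(a * (|code x i| : ℤ)))
        = ∑ v ∈ s.image code, ∏ i, Real.exp (-(a * (|v i| : ℤ))) := by
          rw [Finset.sum_image hinj]
      _ ≤ ∑ v ∈ Fintype.piFinset fun _ : Fin M => ({-1, 0, 1} : Finset ℤ),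
            ∏ i, Real.exp (-(a * (|v i| : ℤ))) := by
          refine Finset.sum_le_sum_of_subset_of_nonneg ?_ fun _ _ _ => by positivity
          intro v hv
          obtain ⟨x, hx, rfl⟩ := Finset.mem_image.1 hv
          exact Fintype.mem_piFinset.2 (hcode x hx)
      _ = (1 + 2 * Real.exp (-a)) ^ M := by
          rw [← Finset.prod_univ_sum (fun _ : Fin M => ({-1, 0, 1} : Finset ℤ))
            fun _ k => Real.exp (-(a * (|k| : ℤ)))]
          rw [Finset.prod_const, Finset.card_univ, Fintype.card_fin]
          congr 1
          rw [Finset.sum_insert (by decide), Finset.sum_insert (by decide), Finset.sum_singleton]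
          simp
          ring
  have hexp : (1 + 2 * Real.exp (-a)) ^ M ≤ Real.exp (2 * Real.exp (-a) * M) := by
    rw [mul_comm _ (M : ℝ), Real.exp_nat_mul]
    refine pow_le_pow_left₀ (by positivity) ?_ M
    linarith [Real.add_one_le_exp (2 * Real.exp (-a))]
  rw [Real.exp_add]
  calc (s.card : ℝ) = Real.exp (a * K) * (s.card * Real.exp (-(a * K))) := by
        rw [mul_left_comm, ← Real.exp_add]
        simp
    _ ≤ _ := mul_le_mul_of_nonneg_left (hlow.trans (hup.trans hexp)) (Real.exp_nonneg _)

/-- Behaviour vectors whose displacements stay within `n / 3` of each other do not bring together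
agents that start at antipodal nodes. -/
lemma ringPos_antipodal_ne {n : ℕ} (hn : 0 < n) (h2 : 2 ∣ n) (Vx Vy : ℕ → ℤ) (t : ℕ)
    (h : 3 * |∑ j ∈ Finset.Icc 1 t, Vy j - ∑ j ∈ Finset.Icc 1 t, Vx j| ≤ n) :
    ringPos n Vx ((n / 2 : ℕ) : ZMod n) t ≠ ringPos n Vy 0 t := by
  intro heq
  obtain ⟨m, rfl⟩ := h2
  rw [Nat.mul_div_cancel_left m two_pos] at heq
  unfold ringPos at heq
  generalize ∑ j ∈ Finset.Icc 1 t, Vx j = X at *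
  generalize ∑ j ∈ Finset.Icc 1 t, Vy j = Y at *
  have h0 : ((m + X : ℤ) : ZMod (2 * m)) = (Y : ℤ) := by
    push_cast
    simpa using heq
  obtain ⟨k, hk⟩ := (ZMod.intCast_eq_intCast_iff_dvd_sub _ _ _).1 h0
  push_cast at h hk
  have hYX : Y - X = m * (2 * k + 1) := by linarith
  rw [hYX, abs_mul, Nat.abs_cast] at h
  have : 1 ≤ |2 * k + 1| := Int.one_le_abs (by omega)
  have hm : (0 : ℤ) < m := by omega
  nlinarith

/-- Theorem 2: for every `c > 0` there are `γ > 0` and `L₀` such that for all `L ≥ L₀` and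
every positive multiple `n` of 6, any rendezvous algorithm on the oriented ring of size `n`
with simultaneous start whose executions all have meeting time at most `c·E·log₂ L`
(where `E = n − 1`) has some execution of cost at least `γ·E·log₂ L`. -/
theorem fast_time_implies_expensive_cost (c : ℝ) (hc : 0 < c) :
    ∃ γ : ℝ, 0 < γ ∧ ∃ L₀ : ℕ, ∀ L : ℕ, L₀ ≤ L → ∀ n : ℕ, 0 < n → 6 ∣ n →
      ∀ A : ℕ → ℕ → ℤ,
        (∀ x ∈ Finset.Icc 1 L, ∀ j, 1 ≤ j → A x j = -1 ∨ A x j = 0 ∨ A x j = 1) →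
        (∀ x ∈ Finset.Icc 1 L, ∀ y ∈ Finset.Icc 1 L, x ≠ y →
          ∀ p q : ZMod n, p ≠ q → ∃ t, ringPos n (A x) p t = ringPos n (A y) q t) →
        (∀ x ∈ Finset.Icc 1 L, ∀ y ∈ Finset.Icc 1 L, x ≠ y →
          ∀ p q : ZMod n, p ≠ q →
            (ringMeetTime n (A x) (A y) p q : ℝ)
              ≤ c * ((n - 1 : ℕ) : ℝ) * Real.logb 2 (L : ℝ)) →
        ∃ x ∈ Finset.Icc 1 L, ∃ y ∈ Finset.Icc 1 L, x ≠ y ∧ ∃ p q : ZMod n, p ≠ q ∧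
          γ * ((n - 1 : ℕ) : ℝ) * Real.logb 2 (L : ℝ)
            ≤ (ringExecCost n (A x) (A y) p q : ℝ) := by
  refine ⟨1 / (48 * (96 * c)), by positivity, 2, ?_⟩
  intro L hL n hn h6 A hA hmeet htime
  by_contra! hcost
  set γ : ℝ := 1 / (48 * (96 * c)) with hγ
  set l : ℝ := Real.logb 2 L with hl
  have hL0 : (0 : ℝ) < L := by exact_mod_cast (by omega : 0 < L)
  have hl1 : 0 < l := Real.logb_pos (by norm_num) (by exact_mod_cast (by omega : 1 < L))
  have hγ0 : 0 < γ := by positivity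
  obtain ⟨δ, hδ⟩ : ∃ δ, δ = n / 12 + 1 := ⟨_, rfl⟩
  have hδ0 : 0 < δ := by omega
  have hE : ((n - 1 : ℕ) : ℝ) ≤ 12 * δ := by exact_mod_cast (by omega : n - 1 ≤ 12 * δ)
  have hA' : ∀ x ∈ Finset.Icc 1 L, ∀ j, 1 ≤ j → |A x j| ≤ 1 := by
    intro x hx j hj
    rcases hA x hx j hj with h | h | h <;> simp [h]
  have hcodes : ∀ x, ∃ u : ℕ → ℤ, x ∈ Finset.Icc 1 L →
      (∀ i, u i ∈ ({-1, 0, 1} : Finset ℤ)) ∧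
      (∀ k, (δ : ℝ) * ((∑ i ∈ Finset.range k, |u i| : ℤ) : ℝ) ≤ γ * ((n - 1 : ℕ) : ℝ) * l) ∧
      ∀ t, (((Finset.Icc 1 t).filter fun j => A x j ≠ 0).card : ℝ) ≤ γ * ((n - 1 : ℕ) : ℝ) * l →
        |∑ j ∈ Finset.Icc 1 t, A x j - δ * ∑ i ∈ Finset.range (t / δ), u i|
          ≤ 2 * ((δ : ℤ) - 1) := by
    intro x
    by_cases hx : x ∈ Finset.Icc 1 L
    · obtain ⟨u, hu⟩ := exists_sparse_code (A x) (hA' x hx)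
        (by positivity : 0 ≤ γ * ((n - 1 : ℕ) : ℝ) * l) hδ0
      exact ⟨u, fun _ => hu⟩
    · exact ⟨0, fun h => absurd h hx⟩
  choose u hu using hcodes
  set M : ℕ := ⌊12 * c * l⌋₊ with hM
  have hinj : Set.InjOn (fun x (i : Fin M) => u x i) (Finset.Icc 1 L : Finset ℕ) := by
    intro x hx y hy hxy
    by_contra hne
    have hp : ((n / 2 : ℕ) : ZMod n) ≠ 0 := by
      rw [Ne, ZMod.natCast_eq_zero_iff]
      exact Nat.not_dvd_of_pos_of_lt (by omega) (by omega)
    have hpos := Nat.sInf_mem (hmeet x hx y hy hne _ _ hp)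
    have ht := htime x hx y hy hne _ _ hp
    have hc' := hcost x hx y hy hne _ _ hp
    unfold ringExecCost at hc'
    change ringPos n (A x) _ (ringMeetTime n (A x) (A y) ((n / 2 : ℕ) : ZMod n) 0) =
      ringPos n (A y) _ (ringMeetTime n (A x) (A y) ((n / 2 : ℕ) : ZMod n) 0) at hpos
    generalize ringMeetTime n (A x) (A y) ((n / 2 : ℕ) : ZMod n) 0 = t at *
    refine ringPos_antipodal_ne hn (dvd_trans (by norm_num) h6) _ _ t ?_ hpos
    push_cast at hc'
    have hX := (hu x hx).2.2 t (by
      linarith [Nat.cast_nonneg (α := ℝ) ((Finset.Icc 1 t).filter fun j => A y j ≠ 0).card])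
    have hY := (hu y hy).2.2 t (by
      linarith [Nat.cast_nonneg (α := ℝ) ((Finset.Icc 1 t).filter fun j => A x j ≠ 0).card])
    have htM : t / δ ≤ M := by
      refine Nat.le_floor (Nat.cast_div_le.trans ?_)
      rw [div_le_iff₀ (by exact_mod_cast hδ0)]
      calc (t : ℝ) ≤ c * ((n - 1 : ℕ) : ℝ) * l := ht
        _ ≤ c * (12 * δ) * l := by gcongr
        _ = 12 * c * l * δ := by ring
    have hsum : ∑ i ∈ Finset.range (t / δ), u x i = ∑ i ∈ Finset.range (t / δ), u y i :=
      Finset.sum_congr rfl fun i hi =>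
        congrFun hxy ⟨i, (Finset.mem_range.1 hi).trans_le htM⟩
    rw [hsum] at hX
    have hδn : 12 * ((δ : ℤ) - 1) ≤ n := by omega
    generalize (δ : ℤ) * ∑ i ∈ Finset.range (t / δ), u y i = Z at *
    grind
  have hcard := card_le_of_sparse_codes (Finset.Icc 1 L) M (fun x i => u x i) hinj
    (fun x hx i => (hu x hx).1 i) (a := 96 * c) (K := 12 * γ * l) (by positivity) (by
      intro x hx
      have h := (hu x hx).2.1 M
      rw [Finset.sum_range] at h
      have h' : γ * ((n - 1 : ℕ) : ℝ) * l ≤ δ * (12 * γ * l) := by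
        calc γ * ((n - 1 : ℕ) : ℝ) * l ≤ γ * (12 * δ) * l := by gcongr
          _ = δ * (12 * γ * l) := by ring
      exact le_of_mul_le_mul_left (h.trans h') (by exact_mod_cast hδ0))
  have hMle : (M : ℝ) ≤ 12 * c * l := Nat.floor_le (by positivity)
  have hexp : Real.exp (-(96 * c)) * (96 * c) ≤ 1 := by
    rw [Real.exp_neg, inv_mul_le_one₀ (Real.exp_pos _)]
    linarith [Real.add_one_le_exp (96 * c)]
  have h₁ : 96 * c * (12 * γ * l) = l / 4 := by
    rw [hγ]
    field_simp
    norm_num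
  have h₂ : 2 * Real.exp (-(96 * c)) * M ≤ l / 4 := by
    calc 2 * Real.exp (-(96 * c)) * M ≤ 2 * Real.exp (-(96 * c)) * (12 * c * l) := by gcongr
      _ = Real.exp (-(96 * c)) * (96 * c) * (l / 4) := by ring
      _ ≤ 1 * (l / 4) := by gcongr
      _ = l / 4 := one_mul _
  have hlog : Real.log L = l * Real.log 2 := by
    rw [hl, Real.logb, div_mul_cancel₀ _ (Real.log_pos (by norm_num)).ne']
  rw [Nat.card_Icc, Nat.add_sub_cancel, ← Real.log_le_iff_le_exp hL0, hlog, h₁] at hcard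
  nlinarith [Real.log_two_gt_d9]
end

section
/- Let f : ℕ → ℤ satisfy f 0 = 0 and |f(j+1) − f j| ≤ 1 for all j. Fix T ∈ ℕ, and let Fwd = max_{0 ≤ t ≤ T} f t and Bck = max_{0 ≤ t ≤ T} (−f t). Then the number of indices j ∈ {0,…,T−1} with f(j+1) ≠ f j is at least Fwd + Bck + min(Fwd, Bck). -/
/-- The displacement between two times is at most the number of moves made between them. -/
theorem abs_sub_add_card_moves_le (f : ℕ → ℤ) (hstep : ∀ j, |f (j + 1) - f j| ≤ 1) {a b : ℕ}
    (hab : a ≤ b) :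
    |f b - f a| + (((Finset.range a).filter fun j => f (j + 1) ≠ f j).card : ℤ)
      ≤ (((Finset.range b).filter fun j => f (j + 1) ≠ f j).card : ℤ) := by
  induction b, hab using Nat.le_induction with
  | base => simp
  | succ b _ ih =>
    have hb := hstep b
    rw [Finset.range_add_one, Finset.filter_insert]
    split_ifs with h
    · rw [Finset.card_insert_of_notMem (by simp)]
      push_cast
      linarith [abs_sub_le (f (b + 1)) (f b) (f a)]
    · rw [not_not.mp h]
      exact ih

/-- A walker on the integer line starts at 0 and in each round moves at most one step.
Its number of moves up to time `T` is at least `Fwd + Bck + min Fwd Bck`, where `Fwd` and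
`Bck` are its maximal displacements in the two directions up to time `T`. -/
theorem walk_cost_lower_bound (f : ℕ → ℤ) (h0 : f 0 = 0)
    (hstep : ∀ j, |f (j + 1) - f j| ≤ 1) (T : ℕ) (Fwd Bck : ℤ)
    (hFwd : Fwd = (Finset.range (T + 1)).sup' (by simp) f)
    (hBck : Bck = (Finset.range (T + 1)).sup' (by simp) fun t => -f t) :
    Fwd + Bck + min Fwd Bck
      ≤ (((Finset.range T).filter fun j => f (j + 1) ≠ f j).card : ℤ) := by
  obtain ⟨a, ha, hfa⟩ := (Finset.range (T + 1)).exists_mem_eq_sup' (by simp) f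
  obtain ⟨b, hb, hfb⟩ := (Finset.range (T + 1)).exists_mem_eq_sup' (by simp) fun t => -f t
  rw [hfa] at hFwd
  rw [hfb] at hBck
  have haT : a ≤ T := Finset.mem_range_succ_iff.mp ha
  have hbT : b ≤ T := Finset.mem_range_succ_iff.mp hb
  have ha₀ := abs_sub_add_card_moves_le f hstep a.zero_le
  have hb₀ := abs_sub_add_card_moves_le f hstep b.zero_le
  have ha₁ := abs_sub_add_card_moves_le f hstep haT
  have hb₁ := abs_sub_add_card_moves_le f hstep hbT
  simp only [h0, Finset.range_zero, Finset.filter_empty, Finset.card_empty, Nat.cast_zero,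
    sub_zero, add_zero] at ha₀ hb₀
  have hminF := min_le_left Fwd Bck
  have hminB := min_le_right Fwd Bck
  rcases le_total a b with hab | hab
  · have h := abs_sub_add_card_moves_le f hstep hab
    linarith [neg_abs_le (f b - f a), le_abs_self (f a), abs_nonneg (f T - f b)]
  · have h := abs_sub_add_card_moves_le f hstep hab
    linarith [le_abs_self (f a - f b), neg_abs_le (f b), abs_nonneg (f T - f a)]
end

section
/- Let f, g : ℕ → ℤ satisfy f 0 = g 0 = 0, |f(j+1) − f j| ≤ 1 and |g(j+1) − g j| ≤ 1 for all j. Fix T ∈ ℕ and an integer n ≥ 1, and suppose that (max_{0 ≤ t ≤ T} f t − min_{0 ≤ t ≤ T} f t) + (max_{0 ≤ t ≤ T} g t − min_{0 ≤ t ≤ T} g t) + 2 ≤ n. Then there exists an integer d such that f s ≢ d + g t (mod n) for all s, t ∈ {0,…,T}. -/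
/-- Two walkers on the integer line start at 0 and move at most one step per round. If the
segments they explore during the first `T` rounds together span at most `n` nodes (counting
the two endpoints), then, placing the walks on the cycle of `n` nodes, the second walk can be
translated by some `d` so that the two walks visit disjoint sets of nodes up to time `T`. -/
theorem disjoint_translation (f g : ℕ → ℤ) (hf0 : f 0 = 0) (hg0 : g 0 = 0)
    (hfstep : ∀ j, |f (j + 1) - f j| ≤ 1) (hgstep : ∀ j, |g (j + 1) - g j| ≤ 1)
    (T : ℕ) (n : ℤ) (hn : 1 ≤ n)
    (hspan :
      ((Finset.range (T + 1)).sup' (by simp) f - (Finset.range (T + 1)).inf' (by simp) f) +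
        ((Finset.range (T + 1)).sup' (by simp) g - (Finset.range (T + 1)).inf' (by simp) g) + 2
        ≤ n) :
    ∃ d : ℤ, ∀ s ≤ T, ∀ t ≤ T, ¬ f s ≡ d + g t [ZMOD n] := by
  refine ⟨(Finset.range (T + 1)).sup' (by simp) f + 1 - (Finset.range (T + 1)).inf' (by simp) g,
    fun s hs t ht h => ?_⟩
  have hs' : s ∈ Finset.range (T + 1) := Finset.mem_range_succ_iff.mpr hs
  have ht' : t ∈ Finset.range (T + 1) := Finset.mem_range_succ_iff.mpr ht
  have hf_le := Finset.le_sup' f hs'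
  have hf_ge := Finset.inf'_le f hs'
  have hg_le := Finset.le_sup' g ht'
  have hg_ge := Finset.inf'_le g ht'
  have hle := Int.le_of_dvd (by linarith) h.dvd
  linarith
end

section
/- Let n ≥ 2, E = n − 1, F = ⌈E/2⌉, and let V_A and V_B be behaviour vectors. Consider the execution on the oriented ring of size n in which agent A starts at node 0 and agent B starts at node F, and suppose the agents meet at time T ≥ 1, i.e., Σ_{j=1}^{T} V_A j ≡ F + Σ_{j=1}^{T} V_B j (mod n). Suppose moreover that the number of indices j ∈ {1,…,T} with V_A j ≠ 0 plus the number of indices j ∈ {1,…,T} with V_B j ≠ 0 is at most E + φ for some integer φ with 0 ≤ φ < F. Then, writing disp_A = Σ_{j=1}^{T} V_A j and disp_B = Σ_{j=1}^{T} V_B j (sums in ℤ), exactly one of the two inequalities disp_A ≥ disp_B + F and disp_B ≥ disp_A + F holds. -/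
/-- Exactly one agent is eager: if the agents starting at nodes `0` and `F` of the oriented
ring of size `n` (with `E = n − 1`, `F = ⌈E/2⌉`) meet at time `T ≥ 1` at total cost at most
`E + φ` with `0 ≤ φ < F`, then exactly one of the two displacement inequalities
`disp_A ≥ disp_B + F`, `disp_B ≥ disp_A + F` holds. -/
theorem exactly_one_eager (n E F : ℕ) (hn : 2 ≤ n) (hE : E = n - 1) (hF : F = (E + 1) / 2)
    (VA VB : ℕ → ℤ)
    (hVA : ∀ j, 1 ≤ j → VA j = -1 ∨ VA j = 0 ∨ VA j = 1)
    (hVB : ∀ j, 1 ≤ j → VB j = -1 ∨ VB j = 0 ∨ VB j = 1)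
    (T : ℕ) (hT : 1 ≤ T)
    (hmeet : ringPos n VA 0 T = ringPos n VB ((F : ℕ) : ZMod n) T)
    (φ : ℕ) (hφ : φ < F)
    (hcost : ((Finset.Icc 1 T).filter fun j => VA j ≠ 0).card +
        ((Finset.Icc 1 T).filter fun j => VB j ≠ 0).card ≤ E + φ) :
    Xor' (∑ j ∈ Finset.Icc 1 T, VB j + (F : ℤ) ≤ ∑ j ∈ Finset.Icc 1 T, VA j)
      (∑ j ∈ Finset.Icc 1 T, VA j + (F : ℤ) ≤ ∑ j ∈ Finset.Icc 1 T, VB j) := by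
  unfold ringPos at hmeet
  generalize ∑ j ∈ Finset.Icc 1 T, VA j = a at hmeet ⊢
  generalize ∑ j ∈ Finset.Icc 1 T, VB j = b at hmeet ⊢
  have hcongr : ((F + b : ℤ) : ZMod n) = (a : ZMod n) := by
    push_cast
    rw [← hmeet, zero_add]
  obtain ⟨k, hk⟩ := (ZMod.intCast_eq_intCast_iff_dvd_sub _ _ _).mp hcongr
  rcases le_or_gt 0 k with h | h
  · have : 0 ≤ (n : ℤ) * k := by positivity
    exact Or.inl ⟨by omega, by omega⟩
  · have : (n : ℤ) * k ≤ -n := by nlinarith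
    exact Or.inr ⟨by omega, by omega⟩
end

section
/- In the computation of the progress vector Prog from Agg, consider any iteration of the while-loop, with s the current start index and a, b the indices computed in that iteration. Then s ≤ a < b ≤ M, Agg a = Agg b ≠ 0, and the final progress vector satisfies Prog a = Prog b = Agg b; moreover, the index b of each iteration is strictly smaller than the index a of the next iteration (so the pairs (a, b) produced over all iterations form a strictly increasing sequence of indices). -/
/-- `surplus Agg s i = Σ_{j=s}^{i} Agg j`. -/
def surplus (Agg : ℕ → ℤ) (s i : ℕ) : ℤ := ∑ j ∈ Finset.Icc s i, Agg j

/-- The list of pairs `(a, b)` produced by the while-loop of the progress-vector procedure,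
started at index `s`: while `s ≤ M` and some `k ∈ {s,…,M}` has `|surplus(s,k)| = 2`, let `b`
be the smallest such `k`, let `a` be the smallest index in `{s,…,b}` with `|surplus(s,i)| ≥ 1`
for all `i ∈ {a,…,b}`, record `(a, b)` and continue from `s := b + 1`. -/
def progPairs (Agg : ℕ → ℤ) (M : ℕ) (s : ℕ) : List (ℕ × ℕ) :=
  if h : ∃ k, k ∈ Finset.Icc s M ∧ |surplus Agg s k| = 2 then
    let b := Nat.find h
    have hb := Nat.find_spec h
    have hex : ∃ a, s ≤ a ∧ ∀ i ∈ Finset.Icc a b, 1 ≤ |surplus Agg s i| := by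
      refine ⟨b, (Finset.mem_Icc.mp hb.1).1, ?_⟩
      intro i hi
      rw [Finset.mem_Icc] at hi
      have hib : i = b := le_antisymm hi.2 hi.1
      rw [hib, hb.2]
      norm_num
    let a := Nat.find hex
    (a, b) :: progPairs Agg M (b + 1)
  else []
  termination_by M + 1 - s
  decreasing_by
    have hb := Nat.find_spec h
    have h1 := Finset.mem_Icc.mp hb.1
    omega

/-- The progress vector of `Agg` (over indices `1,…,M`): entries at the recorded indices
`a`, `b` of each iteration are set to `Agg b`; all other entries are 0. -/
def progVec (Agg : ℕ → ℤ) (M : ℕ) (i : ℕ) : ℤ :=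
  match (progPairs Agg M 1).find? (fun p => p.1 == i || p.2 == i) with
  | some p => Agg p.2
  | none => 0

theorem surplus_self (Agg : ℕ → ℤ) (s : ℕ) : surplus Agg s s = Agg s := by
  simp [surplus]

theorem surplus_succ (Agg : ℕ → ℤ) {s i : ℕ} (h : s ≤ i) :
    surplus Agg s (i + 1) = surplus Agg s i + Agg (i + 1) :=
  Finset.sum_Icc_succ_top (by omega) Agg

/-- Before the surplus first reaches absolute value `2`, it stays in `{-1, 0, 1}`. -/
theorem abs_surplus_le_one {Agg : ℕ → ℤ} (hAgg : ∀ i, Agg i = -1 ∨ Agg i = 0 ∨ Agg i = 1)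
    {s b : ℕ} (hlt : ∀ k, s ≤ k → k < b → |surplus Agg s k| ≠ 2) {k : ℕ} (hsk : s ≤ k)
    (hkb : k < b) : |surplus Agg s k| ≤ 1 := by
  induction k, hsk using Nat.le_induction with
  | base =>
    rw [surplus_self]
    rcases hAgg s with h | h | h <;> simp [h]
  | succ k hsk ih =>
    have h1 := ih (by omega)
    have h2 := hlt (k + 1) (by omega) hkb
    rw [surplus_succ Agg hsk] at h2 ⊢
    rcases hAgg (k + 1) with h | h | h <;> grind

/-- If the surplus from `s` first reaches absolute value `2` at `b`, and `a` is the start of the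
final run of nonzero surpluses, then `a < b` and `Agg` has the same nonzero value at both. -/
theorem agg_eq_of_first_surplus {Agg : ℕ → ℤ}
    (hAgg : ∀ i, Agg i = -1 ∨ Agg i = 0 ∨ Agg i = 1) {s a b : ℕ} (hsb : s ≤ b)
    (hb : |surplus Agg s b| = 2) (hlt : ∀ k, s ≤ k → k < b → |surplus Agg s k| ≠ 2)
    (hsa : s ≤ a) (ha : ∀ i ∈ Finset.Icc a b, 1 ≤ |surplus Agg s i|)
    (hmin : ∀ a' < a, ¬ (s ≤ a' ∧ ∀ i ∈ Finset.Icc a' b, 1 ≤ |surplus Agg s i|)) :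
    a < b ∧ Agg a = Agg b ∧ Agg b ≠ 0 := by
  have hne : s ≠ b := by
    rintro rfl
    rw [surplus_self] at hb
    rcases hAgg s with h | h | h <;> simp [h] at hb
  obtain ⟨c, rfl⟩ : ∃ c, b = c + 1 := ⟨b - 1, by omega⟩
  have hsc : s ≤ c := by omega
  have hc := abs_surplus_le_one hAgg hlt hsc (by omega)
  have hstep := surplus_succ Agg hsc
  have hcv : surplus Agg s c = Agg (c + 1) ∧ Agg (c + 1) ≠ 0 := by
    rcases hAgg (c + 1) with h | h | h <;> grind
  have hac : a ≤ c := by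
    by_contra hcon
    refine hmin c (by omega) ⟨hsc, fun i hi => ?_⟩
    rw [Finset.mem_Icc] at hi
    obtain rfl | rfl : i = c ∨ i = c + 1 := by omega
    · rw [hcv.1]
      exact Int.one_le_abs hcv.2
    · omega
  have hconst : surplus Agg s a = Agg (c + 1) := by
    refine Nat.decreasingInduction' (P := fun i => surplus Agg s i = Agg (c + 1))
      (fun k hkc hak ih => ?_) hac hcv.1
    have h1 := surplus_succ Agg (hsa.trans hak)
    have h2 := abs_surplus_le_one hAgg hlt (hsa.trans hak) (by omega)
    have h3 := ha k (Finset.mem_Icc.mpr ⟨hak, by omega⟩)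
    rcases hAgg (k + 1) with h | h | h <;> rcases hAgg (c + 1) with h' | h' | h' <;> grind
  refine ⟨by omega, ?_, hcv.2⟩
  rcases hsa.eq_or_lt with rfl | hsa'
  · rwa [surplus_self] at hconst
  obtain ⟨d, rfl⟩ : ∃ d, a = d + 1 := ⟨a - 1, by omega⟩
  have hd : surplus Agg s d = 0 := by
    by_contra hd
    refine hmin d (by omega) ⟨by omega, fun i hi => ?_⟩
    rw [Finset.mem_Icc] at hi
    rcases hi.1.eq_or_lt with rfl | hdi
    · exact Int.one_le_abs hd
    · exact ha i (Finset.mem_Icc.mpr ⟨hdi, hi.2⟩)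
  rwa [surplus_succ Agg (by omega), hd, zero_add] at hconst

theorem progPairs_eq_nil_or_cons {Agg : ℕ → ℤ}
    (hAgg : ∀ i, Agg i = -1 ∨ Agg i = 0 ∨ Agg i = 1) (M s : ℕ) :
    progPairs Agg M s = [] ∨ ∃ a b, progPairs Agg M s = (a, b) :: progPairs Agg M (b + 1) ∧
      s ≤ a ∧ a < b ∧ b ≤ M ∧ Agg a = Agg b ∧ Agg b ≠ 0 := by
  rw [progPairs]
  split_ifs with h
  · right
    obtain ⟨hmem, hb⟩ := Nat.find_spec h
    rw [Finset.mem_Icc] at hmem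
    have hex : ∃ a, s ≤ a ∧ ∀ i ∈ Finset.Icc a (Nat.find h), 1 ≤ |surplus Agg s i| := by
      refine ⟨Nat.find h, hmem.1, fun i hi => ?_⟩
      rw [Finset.Icc_self, Finset.mem_singleton] at hi
      rw [hi, hb]
      norm_num
    have hlt : ∀ k, s ≤ k → k < Nat.find h → |surplus Agg s k| ≠ 2 := fun k hsk hkb hk =>
      Nat.find_min h hkb ⟨Finset.mem_Icc.mpr ⟨hsk, by omega⟩, hk⟩
    have key := agg_eq_of_first_surplus hAgg hmem.1 hb hlt (Nat.find_spec hex).1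
      (Nat.find_spec hex).2 (fun a' h' => Nat.find_min hex h')
    exact ⟨Nat.find hex, Nat.find h, rfl, (Nat.find_spec hex).1, key.1, hmem.2, key.2⟩
  · exact Or.inl rfl

theorem of_mem_progPairs {Agg : ℕ → ℤ} (hAgg : ∀ i, Agg i = -1 ∨ Agg i = 0 ∨ Agg i = 1)
    {M s : ℕ} {p : ℕ × ℕ} (hp : p ∈ progPairs Agg M s) :
    s ≤ p.1 ∧ p.1 < p.2 ∧ p.2 ≤ M ∧ Agg p.1 = Agg p.2 ∧ Agg p.2 ≠ 0 := by
  induction hn : M + 1 - s using Nat.strong_induction_on generalizing s with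
  | _ n ih =>
    obtain h | ⟨a, b, h, hsa, hab, hbM, hA⟩ := progPairs_eq_nil_or_cons hAgg M s
    · simp [h] at hp
    · rw [h, List.mem_cons] at hp
      rcases hp with rfl | hp
      · exact ⟨hsa, hab, hbM, hA⟩
      · have := ih (M + 1 - (b + 1)) (by omega) hp rfl
        exact ⟨by omega, this.2⟩

theorem pairwise_progPairs {Agg : ℕ → ℤ} (hAgg : ∀ i, Agg i = -1 ∨ Agg i = 0 ∨ Agg i = 1)
    (M s : ℕ) : (progPairs Agg M s).Pairwise (fun p q => p.2 < q.1) := by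
  induction hn : M + 1 - s using Nat.strong_induction_on generalizing s with
  | _ n ih =>
    obtain h | ⟨a, b, h, hsa, hab, hbM, -⟩ := progPairs_eq_nil_or_cons hAgg M s
    · simp [h]
    · rw [h, List.pairwise_cons]
      exact ⟨fun q hq => (of_mem_progPairs hAgg hq).1, ih _ (by omega) _ rfl⟩

/-- At every recorded index the progress vector agrees with `Agg`. -/
theorem progVec_eq_of_mem {Agg : ℕ → ℤ} (hAgg : ∀ i, Agg i = -1 ∨ Agg i = 0 ∨ Agg i = 1)
    {M i : ℕ} {p : ℕ × ℕ} (hp : p ∈ progPairs Agg M 1) (hi : p.1 = i ∨ p.2 = i) :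
    progVec Agg M i = Agg i := by
  unfold progVec
  split
  · next q hq =>
    have hA := (of_mem_progPairs hAgg (List.mem_of_find?_eq_some hq)).2.2.2.1
    have hqi := List.find?_some hq
    simp only [Bool.or_eq_true, beq_iff_eq] at hqi
    rcases hqi with rfl | rfl
    · exact hA.symm
    · rfl
  · next hq =>
    have := List.find?_eq_none.mp hq p hp
    simp only [Bool.or_eq_true, beq_iff_eq] at this
    exact absurd hi this

/-- Properties of each iteration of the progress-vector procedure: with `s` the current start
index and `(a, b)` the pair computed in that iteration, `s ≤ a < b ≤ M`,
`Agg a = Agg b ≠ 0`, the final progress vector has `Prog a = Prog b = Agg b`, and the `b` of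
each iteration is smaller than the `a` of the next. -/
theorem progPairs_properties (M : ℕ) (hM : 1 ≤ M) (Agg : ℕ → ℤ)
    (hAgg : ∀ i, Agg i = -1 ∨ Agg i = 0 ∨ Agg i = 1)
    (j : ℕ) (hj : j < (progPairs Agg M 1).length) :
    (if h0 : j = 0 then 1
      else ((progPairs Agg M 1).get ⟨j - 1, by omega⟩).2 + 1)
        ≤ ((progPairs Agg M 1).get ⟨j, hj⟩).1 ∧
    ((progPairs Agg M 1).get ⟨j, hj⟩).1 < ((progPairs Agg M 1).get ⟨j, hj⟩).2 ∧
    ((progPairs Agg M 1).get ⟨j, hj⟩).2 ≤ M ∧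
    Agg ((progPairs Agg M 1).get ⟨j, hj⟩).1 = Agg ((progPairs Agg M 1).get ⟨j, hj⟩).2 ∧
    Agg ((progPairs Agg M 1).get ⟨j, hj⟩).2 ≠ 0 ∧
    progVec Agg M ((progPairs Agg M 1).get ⟨j, hj⟩).1
      = Agg ((progPairs Agg M 1).get ⟨j, hj⟩).2 ∧
    progVec Agg M ((progPairs Agg M 1).get ⟨j, hj⟩).2
      = Agg ((progPairs Agg M 1).get ⟨j, hj⟩).2 ∧
    ∀ hj' : j + 1 < (progPairs Agg M 1).length,
      ((progPairs Agg M 1).get ⟨j, hj⟩).2 < ((progPairs Agg M 1).get ⟨j + 1, hj'⟩).1 := by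
  have hmem := List.get_mem (progPairs Agg M 1) ⟨j, hj⟩
  obtain ⟨h1, hab, hbM, hA, hne⟩ := of_mem_progPairs hAgg hmem
  have hpw := List.pairwise_iff_get.mp (pairwise_progPairs hAgg M 1)
  refine ⟨?_, hab, hbM, hA, hne, (progVec_eq_of_mem hAgg hmem (Or.inl rfl)).trans hA,
    progVec_eq_of_mem hAgg hmem (Or.inr rfl), fun hj' => hpw _ _ (Nat.lt_succ_self j)⟩
  split_ifs with h0
  · exact h1
  · exact hpw ⟨j - 1, by omega⟩ ⟨j, hj⟩ (Nat.sub_one_lt h0)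
end

section
/- Let n be a positive multiple of 6 and M ≥ 1. Let V be a behaviour vector, Agg = Agg_{V,0} its aggregate behaviour vector over M blocks, and Prog the progress vector of Agg. Suppose a_1 < b_1 < a_2 < b_2 < … < a_k < b_k are indices in {1,…,M} such that for each i ∈ {1,…,k}, Prog a_i = Prog b_i ≠ 0 and Prog d = 0 for all d with a_i < d < b_i. Then the number of rounds j ∈ {1,…,M·(n/6)} with V j ≠ 0 is at least k·(n−1)/6. -/
/-- The index `j ∈ {0,…,5}` of the sector `P_j = {j·(n/6), …, (j+1)·(n/6) − 1}` containing a
node of the oriented ring of size `n` (a positive multiple of 6). -/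
def sectorIdx (n : ℕ) (v : ZMod n) : ℕ := v.val / (n / 6)

/-- The aggregate behaviour vector `Agg_{V,p}` over blocks `B_1, B_2, …` (block `B_i`
consists of rounds `(i−1)(n/6)+1, …, i(n/6)`): `Agg_{V,p}[i] = z ∈ {-1,0,1}` if the index of
the sector containing the agent's position at the beginning of block `B_{i+1}` is `j + z`
(mod 6), where `j` is the index of the sector containing its position at the beginning of
block `B_i`. -/
def aggVec (n : ℕ) (Vv : ℕ → ℤ) (p : ZMod n) (i : ℕ) : ℤ :=
  let j := sectorIdx n (ringPos n Vv p ((i - 1) * (n / 6)))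
  let j' := sectorIdx n (ringPos n Vv p (i * (n / 6)))
  if (j' : ZMod 6) = (j : ZMod 6) + 1 then 1
  else if (j' : ZMod 6) = (j : ZMod 6) then 0
  else -1

/-- A net displacement costs at least as many moves as its absolute value. -/
lemma abs_sum_Ioc_le_card_moves {V : ℕ → ℤ} (hV : ∀ j, 1 ≤ j → V j = -1 ∨ V j = 0 ∨ V j = 1)
    (u t : ℕ) :
    |∑ j ∈ Finset.Ioc u t, V j| ≤ (((Finset.Ioc u t).filter fun j => V j ≠ 0).card : ℤ) := by
  rw [Finset.card_filter]
  push_cast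
  refine (Finset.abs_sum_le_sum_abs _ _).trans (Finset.sum_le_sum fun j hj => ?_)
  rw [Finset.mem_Ioc] at hj
  rcases hV j (by omega) with h | h | h <;> simp [h]

lemma sum_Icc_one_sub_sum_Icc_one (V : ℕ → ℤ) {u t : ℕ} (h : u ≤ t) :
    ∑ j ∈ Finset.Icc 1 t, V j - ∑ j ∈ Finset.Icc 1 u, V j = ∑ j ∈ Finset.Ioc u t, V j := by
  have := Finset.sum_Ioc_consecutive V (Nat.zero_le u) h
  have e (x : ℕ) : Finset.Icc 1 x = Finset.Ioc 0 x := rfl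
  rw [e, e]
  linarith

/-- The sector index agrees modulo 6 with the unrolled sector index of the lift to `ℤ`. -/
lemma sectorIdx_intCast (m : ℕ) (hm : 0 < m) (x : ℤ) :
    ((sectorIdx (6 * m) ((x : ℤ) : ZMod (6 * m)) : ℕ) : ZMod 6) = ((x / m : ℤ) : ZMod 6) := by
  have : NeZero (6 * m) := ⟨by omega⟩
  have h1 : ((sectorIdx (6 * m) ((x : ℤ) : ZMod (6 * m)) : ℕ) : ℤ) = (x % ((6 * m : ℕ) : ℤ)) / m := by
    unfold sectorIdx
    rw [Nat.mul_div_cancel_left m (by norm_num)]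
    push_cast [ZMod.val_intCast]
    rfl
  have hm' : (m : ℤ) ≠ 0 := by omega
  have h2 : x / m = (x % ((6 * m : ℕ) : ℤ)) / m + 6 * (x / ((6 * m : ℕ) : ℤ)) := by
    rw [← Int.add_mul_ediv_left _ _ hm']
    congr 1
    conv_lhs => rw [← Int.emod_add_mul_ediv x ((6 * m : ℕ) : ℤ)]
    push_cast
    ring
  rw [← Int.cast_natCast, h1, h2]
  push_cast
  rw [show (6 : ZMod 6) = 0 from rfl]
  ring

/-- The aggregate behaviour vector records the increments of the unrolled sector index. -/
lemma aggVec_eq_sub {V : ℕ → ℤ} (hV : ∀ j, 1 ≤ j → V j = -1 ∨ V j = 0 ∨ V j = 1)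
    (m : ℕ) (hm : 0 < m) (i : ℕ) :
    aggVec (6 * m) V 0 (i + 1) =
      (∑ j ∈ Finset.Icc 1 ((i + 1) * m), V j) / m - (∑ j ∈ Finset.Icc 1 (i * m), V j) / m := by
  have hdiff := sum_Icc_one_sub_sum_Icc_one V (Nat.mul_le_mul_right m (Nat.le_succ i))
  have hle : |∑ j ∈ Finset.Ioc (i * m) ((i + 1) * m), V j| ≤ m := by
    refine (abs_sum_Ioc_le_card_moves hV _ _).trans ?_
    have h := Finset.card_filter_le (Finset.Ioc (i * m) ((i + 1) * m)) (fun j => V j ≠ 0)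
    rw [Nat.card_Ioc, add_mul, one_mul, Nat.add_sub_cancel_left] at h
    rw [add_mul, one_mul]
    exact_mod_cast h
  simp only [Nat.succ_eq_add_one] at hdiff
  rw [← hdiff] at hle
  unfold aggVec ringPos
  simp only [zero_add, Nat.mul_div_cancel_left m (show 0 < 6 by norm_num),
    sectorIdx_intCast m hm, Nat.add_sub_cancel]
  generalize (∑ j ∈ Finset.Icc 1 ((i + 1) * m), V j) = y at *
  generalize (∑ j ∈ Finset.Icc 1 (i * m), V j) = x at *
  have hm' : (0 : ℤ) < m := by exact_mod_cast hm
  rw [abs_le] at hle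
  have h1 : y / m ≤ x / m + 1 := by
    rw [← Int.add_mul_ediv_left _ _ hm'.ne']
    exact Int.ediv_le_ediv hm' (by linarith)
  have h2 : x / m ≤ y / m + 1 := by
    rw [← Int.add_mul_ediv_left _ _ hm'.ne']
    exact Int.ediv_le_ediv hm' (by linarith)
  generalize y / (m : ℤ) = q at *
  generalize x / (m : ℤ) = r at *
  have e1 : ((q : ZMod 6) = (r : ZMod 6) + 1) ↔ q % 6 = (r + 1) % 6 := by
    have := ZMod.intCast_eq_intCast_iff' q (r + 1) 6
    push_cast at this
    exact this
  have e2 : ((q : ZMod 6) = (r : ZMod 6)) ↔ q % 6 = r % 6 := by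
    have := ZMod.intCast_eq_intCast_iff' q r 6
    push_cast at this
    exact this
  simp only [e1, e2]
  split_ifs <;> omega

/-- The surplus telescopes to a difference of unrolled sector indices. -/
lemma surplus_aggVec {V : ℕ → ℤ} (hV : ∀ j, 1 ≤ j → V j = -1 ∨ V j = 0 ∨ V j = 1)
    (m : ℕ) (hm : 0 < m) {r i : ℕ} (h : r ≤ i) :
    surplus (fun d => aggVec (6 * m) V 0 d) (r + 1) i =
      (∑ j ∈ Finset.Icc 1 (i * m), V j) / m - (∑ j ∈ Finset.Icc 1 (r * m), V j) / m := by
  induction i, h using Nat.le_induction with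
  | base => simp [surplus]
  | succ i hi ih =>
    unfold surplus at ih ⊢
    rw [Finset.sum_Icc_succ_top (by omega), ih, aggVec_eq_sub hV m hm]
    ring

lemma le_card_moves_of_abs_surplus_eq_two {V : ℕ → ℤ}
    (hV : ∀ j, 1 ≤ j → V j = -1 ∨ V j = 0 ∨ V j = 1) (m : ℕ) (hm : 0 < m) {r i : ℕ}
    (h : r ≤ i) (h2 : |surplus (fun d => aggVec (6 * m) V 0 d) (r + 1) i| = 2) :
    m ≤ ((Finset.Ioc (r * m) (i * m)).filter fun j => V j ≠ 0).card := by
  rw [surplus_aggVec hV m hm h] at h2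
  have hle := abs_sum_Ioc_le_card_moves hV (r * m) (i * m)
  rw [← sum_Icc_one_sub_sum_Icc_one V (Nat.mul_le_mul_right m h)] at hle
  generalize (∑ j ∈ Finset.Icc 1 (i * m), V j) = y at *
  generalize (∑ j ∈ Finset.Icc 1 (r * m), V j) = x at *
  have hm' : (0 : ℤ) < m := by exact_mod_cast hm
  by_contra! hlt
  have hlt' : |y - x| < m := hle.trans_lt (by exact_mod_cast hlt)
  rw [abs_lt] at hlt'
  have h3 : y / m ≤ x / m + 1 := by
    rw [← Int.add_mul_ediv_left _ _ hm'.ne']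
    exact Int.ediv_le_ediv hm' (by linarith)
  have h4 : x / m ≤ y / m + 1 := by
    rw [← Int.add_mul_ediv_left _ _ hm'.ne']
    exact Int.ediv_le_ediv hm' (by linarith)
  rcases abs_eq (by norm_num : (0 : ℤ) ≤ 2) |>.1 h2 with h5 | h5 <;> omega

/-- Each pair produced by the progress procedure accounts for at least `m` moves. -/
lemma length_progPairs_mul_le_card_moves {V : ℕ → ℤ}
    (hV : ∀ j, 1 ≤ j → V j = -1 ∨ V j = 0 ∨ V j = 1) (m : ℕ) (hm : 0 < m) (M r : ℕ) :
    (progPairs (fun d => aggVec (6 * m) V 0 d) M (r + 1)).length * m ≤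
      ((Finset.Ioc (r * m) (M * m)).filter fun j => V j ≠ 0).card := by
  induction hd : M - r using Nat.strong_induction_on generalizing r with
  | _ d ih =>
    rw [progPairs]
    split_ifs with h
    · have hb := Nat.find_spec h
      have hmem := Finset.mem_Icc.1 hb.1
      simp only [List.length_cons]
      generalize Nat.find h = b at *
      have hrest := ih (M - b) (by omega) b rfl
      have hfirst := le_card_moves_of_abs_surplus_eq_two hV m hm (by omega) hb.2
      rw [← Finset.Ioc_union_Ioc_eq_Ioc (Nat.mul_le_mul_right m (show r ≤ b by omega))
        (Nat.mul_le_mul_right m hmem.2), Finset.filter_union, Finset.card_union_of_disjoint]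
      · linarith
      · exact Finset.disjoint_filter_filter (Finset.Ioc_disjoint_Ioc_of_le le_rfl)
    · simp

/-- The indices recorded by the progress procedure. -/
def progSupport (Agg : ℕ → ℤ) (M : ℕ) : Finset ℕ :=
  ((progPairs Agg M 1).map Prod.fst ++ (progPairs Agg M 1).map Prod.snd).toFinset

lemma card_progSupport_le (Agg : ℕ → ℤ) (M : ℕ) :
    (progSupport Agg M).card ≤ 2 * (progPairs Agg M 1).length := by
  refine (List.toFinset_card_le _).trans ?_
  simp only [List.length_append, List.length_map]
  omega

lemma mem_progSupport_of_progVec_ne_zero {Agg : ℕ → ℤ} {M i : ℕ} (h : progVec Agg M i ≠ 0) :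
    i ∈ progSupport Agg M := by
  unfold progVec at h
  split at h
  · next p hp =>
    have h1 := List.mem_of_find?_eq_some hp
    have h2 := List.find?_some hp
    simp only [Bool.or_eq_true, beq_iff_eq] at h2
    simp only [progSupport, List.mem_toFinset, List.mem_append, List.mem_map]
    exact h2.imp (fun e => ⟨p, h1, e⟩) (fun e => ⟨p, h1, e⟩)
  · exact absurd rfl h

/-- A finite set containing `a 1 < b 1 < a 2 < b 2 < … < a k < b k` has at least `2 * k`
elements. -/
lemma two_mul_le_card_of_interleaved {T : Finset ℕ} {k : ℕ} {a b : ℕ → ℕ}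
    (hab : ∀ i, 1 ≤ i → i ≤ k → a i < b i)
    (hchain : ∀ i, 1 ≤ i → i < k → b i < a (i + 1))
    (ha : ∀ i, 1 ≤ i → i ≤ k → a i ∈ T) (hb : ∀ i, 1 ≤ i → i ≤ k → b i ∈ T) :
    2 * k ≤ T.card := by
  have key : ∀ j, j ≤ k → ∃ S ⊆ T, S.card = 2 * j ∧ ∀ x ∈ S, 1 ≤ j ∧ x ≤ b j := by
    intro j
    induction j with
    | zero => exact fun _ => ⟨∅, by simp⟩
    | succ j ih =>
      intro hj
      obtain ⟨S, hST, hcard, hS⟩ := ih (by omega)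
      have hlt := hab (j + 1) (by omega) hj
      have hSa : ∀ x ∈ S, x < a (j + 1) := fun x hx =>
        (hS x hx).2.trans_lt (hchain j (hS x hx).1 (by omega))
      have h1 : a (j + 1) ∉ S := fun h => (hSa _ h).false
      have h2 : b (j + 1) ∉ insert (a (j + 1)) S := by
        rw [Finset.mem_insert]
        rintro (h | h)
        · omega
        · exact (hlt.trans (hSa _ h)).false
      refine ⟨insert (b (j + 1)) (insert (a (j + 1)) S), ?_, ?_, ?_⟩
      · exact Finset.insert_subset (hb _ (by omega) hj)
          (Finset.insert_subset (ha _ (by omega) hj) hST)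
      · rw [Finset.card_insert_of_notMem h2, Finset.card_insert_of_notMem h1, hcard]
        ring
      · intro x hx
        simp only [Finset.mem_insert] at hx
        refine ⟨by omega, ?_⟩
        rcases hx with rfl | rfl | hx
        · exact le_rfl
        · exact hlt.le
        · exact ((hSa x hx).trans hlt).le
  obtain ⟨S, hST, hcard, -⟩ := key k le_rfl
  exact hcard ▸ Finset.card_le_card hST

/-- Nonzero entries of the progress vector force cost: if the progress vector of the aggregate
behaviour vector of `V` (over `M` blocks) contains pairs
`a_1 < b_1 < a_2 < b_2 < … < a_k < b_k` with `Prog a_i = Prog b_i ≠ 0` and `Prog d = 0` for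
`a_i < d < b_i`, then agent `V` moves in at least `k·(n−1)/6` of the rounds `1,…,M·(n/6)`. -/
theorem progress_implies_cost (n M k : ℕ) (hn : 0 < n) (hn6 : 6 ∣ n) (hM : 1 ≤ M)
    (V : ℕ → ℤ) (hV : ∀ j, 1 ≤ j → V j = -1 ∨ V j = 0 ∨ V j = 1)
    (a b : ℕ → ℕ)
    (hrange : ∀ i, 1 ≤ i → i ≤ k → 1 ≤ a i ∧ b i ≤ M)
    (hab : ∀ i, 1 ≤ i → i ≤ k → a i < b i)
    (hchain : ∀ i, 1 ≤ i → i < k → b i < a (i + 1))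
    (hprog : ∀ i, 1 ≤ i → i ≤ k →
      progVec (fun d => aggVec n V 0 d) M (a i) = progVec (fun d => aggVec n V 0 d) M (b i) ∧
      progVec (fun d => aggVec n V 0 d) M (a i) ≠ 0)
    (hzero : ∀ i, 1 ≤ i → i ≤ k → ∀ d, a i < d → d < b i →
      progVec (fun d' => aggVec n V 0 d') M d = 0) :
    (k : ℝ) * ((n : ℝ) - 1) / 6
      ≤ (((Finset.Icc 1 (M * (n / 6))).filter fun j => V j ≠ 0).card : ℝ) := by
  obtain ⟨m, rfl⟩ := hn6
  have hm : 0 < m := by omega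
  have hcount := (two_mul_le_card_of_interleaved hab hchain
    (fun i h1 h2 => mem_progSupport_of_progVec_ne_zero (hprog i h1 h2).2)
    (fun i h1 h2 => mem_progSupport_of_progVec_ne_zero
      ((hprog i h1 h2).1 ▸ (hprog i h1 h2).2))).trans (card_progSupport_le _ M)
  have hcost := length_progPairs_mul_le_card_moves hV m hm M 0
  rw [zero_mul, zero_add] at hcost
  rw [Nat.mul_div_cancel_left m (by norm_num)]
  have hkm := (Nat.mul_le_mul_right m (show k ≤ _ by omega)).trans hcost
  have hkm' : (k : ℝ) * m ≤
      (((Finset.Icc 1 (M * m)).filter fun j => V j ≠ 0).card : ℝ) := by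
    exact_mod_cast hkm
  refine le_trans ?_ hkm'
  push_cast
  have := k.cast_nonneg (α := ℝ)
  linarith
end
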